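/- Let q be an odd prime power, let (a,b) be a valid pair in F_q^2 with a ≠ b, let ω = ω[a,b], and let M be the number of transpositions (2-cycles) of ω, i.e., M is half the cardinality of the set {j ∈ F_q : ω(j) ≠ j and ω(ω(j)) = j}. If b ∉ {-a, 2-a, a/(2a-1)}, then M ∈ {0, 2}. If b ∈ {-a, 2-a, a/(2a-1)}, then, as real numbers, (q - 11√q - 38)/16 ≤ M ≤ (q + 11√q + 70)/16. -/

import Mathlib

open scoped Classical
open Finset

noncomputable section

variable {F : Type*} [Field F] [Fintype F]

/-- `x ∈ R_q`: `x` is a nonzero square in `F`. -/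
def inR (x : F) : Prop := x ≠ 0 ∧ IsSquare x

/-- `x ∈ N_q`: `x` is a nonzero non-square in `F`. -/
def inN (x : F) : Prop := x ≠ 0 ∧ ¬ IsSquare x

/-- `(a, b)` is a valid pair: `ab ∈ R_q` and `(a-1)(b-1) ∈ R_q`. -/
def ValidPair (a b : F) : Prop := inR (a * b) ∧ inR ((a - 1) * (b - 1))

/-- The operation of the quadratic quasigroup `Q_{a,b}`:
`x*y = x + a(y-x)` if `y - x ∈ R_q`, `x*y = x + b(y-x)` if `y - x ∈ N_q`, and `x*x = x`. -/
def qmul (a b x y : F) : F :=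
  if inR (y - x) then x + a * (y - x) else x + b * (y - x)

/-- The extended quadratic character `χ` of `F_q`. -/
def chi (x : F) : ℤ := if x = 0 then 0 else if IsSquare x then 1 else -1

/-- The quadratic map `φ = φ[a,b]`: `φ(x) = ax` if `x ∈ R_q` and `φ(x) = bx` otherwise. -/
def phi (a b x : F) : F := if inR x then a * x else b * x

/-- `ω` satisfies `z = (z₀,z₁,z₂,z₃)` with `j`, where `φE` is the permutation induced by
`φ[a,b]`: `ω(ω(j)) = j`, `χ(j) = z₀`, `χ(φ⁻¹(j)-1) = z₁`, `χ(ω(j)) = z₂`, and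
`χ(φ⁻¹(ω(j))-1) = z₃`. -/
def SatisfiesWith (ω φE : Equiv.Perm F) (z : ℤ × ℤ × ℤ × ℤ) (j : F) : Prop :=
  ω (ω j) = j ∧ chi j = z.1 ∧ chi (φE.symm j - 1) = z.2.1 ∧
    chi (ω j) = z.2.2.1 ∧ chi (φE.symm (ω j) - 1) = z.2.2.2

/-- `ω` satisfies `z` if it satisfies `z` with some `j ∈ F_q`. -/
def Satisfies (ω φE : Equiv.Perm F) (z : ℤ × ℤ × ℤ × ℤ) : Prop :=
  ∃ j : F, SatisfiesWith ω φE z j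

section HeightLemmas
open Polynomial

variable {F : Type*} [Field F]

/-- height of a rational function -/
def rht (r : RatFunc F) : ℕ := max r.num.natDegree r.denom.natDegree

lemma rht_le_of_div (r : RatFunc F) (p s : F[X]) (hs : s ≠ 0) (D : ℕ)
    (hr : r * algebraMap _ _ s = algebraMap _ _ p)
    (hp : p.natDegree ≤ D) (hsd : s.natDegree ≤ D) : rht r ≤ D := by
  have hs' : (algebraMap F[X] (RatFunc F) s) ≠ 0 := by
    simpa using hs
  have hr' : r = algebraMap _ _ p / algebraMap _ _ s := by
    field_simp; exact hr
  have hden : r.denom.natDegree ≤ D := by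
    rw [hr']
    exact (natDegree_le_of_dvd (RatFunc.denom_div_dvd p s) hs).trans hsd
  have hnum : r.num.natDegree ≤ D := by
    by_cases hp0 : p = 0
    · subst hp0
      simp [hr']
    · rw [hr']
      exact (natDegree_le_of_dvd (RatFunc.num_div_dvd p hs) hp0).trans hp
  exact max_le hnum hden

lemma exists_bezout (s₁ p₁ s₂ p₂ : F[X]) (h₁ : IsCoprime p₁ s₁) (h₂ : IsCoprime p₂ s₂) :
    ∃ u v w : F[X], u * (s₁ * s₂) + v * (p₁ * s₂ + p₂ * s₁) + w * (p₁ * p₂) = 1 := by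
  by_contra hcon
  have hI : Ideal.span {s₁ * s₂, p₁ * s₂ + p₂ * s₁, p₁ * p₂} ≠ ⊤ := by
    intro h
    rw [Ideal.eq_top_iff_one] at h
    rw [Ideal.mem_span_insert] at h
    obtain ⟨u, z, hz, h⟩ := h
    rw [Ideal.mem_span_pair] at hz
    obtain ⟨v, w, hz⟩ := hz
    exact hcon ⟨u, v, w, by rw [h, ← hz]; ring⟩
  obtain ⟨m, hm, hle⟩ := Ideal.exists_le_maximal _ hI
  have hmp := hm.isPrime
  have g0 : s₁ * s₂ ∈ m := hle (Ideal.subset_span (by simp))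
  have g1 : p₁ * s₂ + p₂ * s₁ ∈ m := hle (Ideal.subset_span (by simp))
  have g2 : p₁ * p₂ ∈ m := hle (Ideal.subset_span (by simp))
  have n1 : ¬ (p₁ ∈ m ∧ s₁ ∈ m) := by
    rintro ⟨ha, hb⟩
    obtain ⟨u, v, h⟩ := h₁
    exact hmp.ne_top ((Ideal.eq_top_iff_one _).2 (h ▸ m.add_mem (m.mul_mem_left _ ha) (m.mul_mem_left _ hb)))
  have n2 : ¬ (p₂ ∈ m ∧ s₂ ∈ m) := by
    rintro ⟨ha, hb⟩
    obtain ⟨u, v, h⟩ := h₂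
    exact hmp.ne_top ((Ideal.eq_top_iff_one _).2 (h ▸ m.add_mem (m.mul_mem_left _ ha) (m.mul_mem_left _ hb)))
  rcases hmp.mem_or_mem g0 with hs1 | hs2
  · have hp2 : p₂ ∈ m := (hmp.mem_or_mem g2).resolve_left (fun h => n1 ⟨h, hs1⟩)
    have : p₁ * s₂ ∈ m := by
      have := m.sub_mem g1 (m.mul_mem_left p₂ hs1)
      simpa using this
    rcases hmp.mem_or_mem this with h | h
    · exact n1 ⟨h, hs1⟩
    · exact n2 ⟨hp2, h⟩
  · have hp1 : p₁ ∈ m := (hmp.mem_or_mem g2).resolve_right (fun h => n2 ⟨h, hs2⟩)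
    have : p₂ * s₁ ∈ m := by
      have := m.sub_mem g1 (m.mul_mem_left p₁ hs2)
      simpa using this
    rcases hmp.mem_or_mem this with h | h
    · exact n2 ⟨h, hs2⟩
    · exact n1 ⟨hp1, h⟩

lemma coeff_max_ne (p s : F[X]) (hs : s ≠ 0) :
    p.coeff (max p.natDegree s.natDegree) ≠ 0 ∨ s.coeff (max p.natDegree s.natDegree) ≠ 0 := by
  rcases le_total p.natDegree s.natDegree with h | h
  · right; rw [max_eq_right h]; simpa using hs
  · rw [max_eq_left h]
    by_cases hp : p = 0
    · right
      subst hp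
      have : s.natDegree = 0 := by simpa using h
      simp only [natDegree_zero]
      rw [← this]
      simpa using hs
    · left; simpa using hp

lemma four_aux {a b c d : F} (m1 : a ≠ 0 ∨ b ≠ 0) (m2 : c ≠ 0 ∨ d ≠ 0) (z0 : b * d = 0)
    (z1 : a * d + c * b = 0) (z2 : a * c = 0) : False := by
  rcases mul_eq_zero.1 z0 with h | h <;> rcases mul_eq_zero.1 z2 with h' | h' <;> subst h <;>
    subst h' <;> simp_all

lemma rht_add_le (r₁ r₂ : RatFunc F) (A₀ A₁ A₂ : F[X]) (hA : A₀ ≠ 0) (D : ℕ)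
    (d0 : A₀.natDegree ≤ D) (d1 : A₁.natDegree ≤ D) (d2 : A₂.natDegree ≤ D)
    (e1 : algebraMap _ _ A₀ * (r₁ + r₂) = algebraMap _ _ A₁)
    (e2 : algebraMap _ _ A₀ * (r₁ * r₂) = algebraMap _ _ A₂) :
    rht r₁ + rht r₂ ≤ D := by
  set p₁ := r₁.num with hp1
  set s₁ := r₁.denom with hs1
  set p₂ := r₂.num with hp2
  set s₂ := r₂.denom with hs2
  have hs1n : s₁ ≠ 0 := RatFunc.denom_ne_zero _
  have hs2n : s₂ ≠ 0 := RatFunc.denom_ne_zero _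
  have inj := FaithfulSMul.algebraMap_injective F[X] (RatFunc F)
  have hs1' : algebraMap F[X] (RatFunc F) s₁ ≠ 0 := by simpa using hs1n
  have hs2' : algebraMap F[X] (RatFunc F) s₂ ≠ 0 := by simpa using hs2n
  have hr1 : r₁ = algebraMap _ _ p₁ / algebraMap _ _ s₁ := (RatFunc.num_div_denom r₁).symm
  have hr2 : r₂ = algebraMap _ _ p₂ / algebraMap _ _ s₂ := (RatFunc.num_div_denom r₂).symm
  have E1 : A₀ * (p₁ * s₂ + p₂ * s₁) = A₁ * (s₁ * s₂) := by
    apply inj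
    simp only [map_mul, map_add]
    rw [← e1, hr1, hr2]
    field_simp
  have E2 : A₀ * (p₁ * p₂) = A₂ * (s₁ * s₂) := by
    apply inj
    simp only [map_mul]
    rw [← e2, hr1, hr2]
    field_simp
  obtain ⟨u, v, w, huvw⟩ := exists_bezout s₁ p₁ s₂ p₂ (RatFunc.isCoprime_num_denom r₁)
    (RatFunc.isCoprime_num_denom r₂)
  set c := u * A₀ + v * A₁ + w * A₂ with hc
  have hG0 : s₁ * s₂ ≠ 0 := mul_ne_zero hs1n hs2n
  have c0 : c * (s₁ * s₂) = A₀ := by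
    linear_combination A₀ * huvw - v * E1 - w * E2
  have c1 : c * (p₁ * s₂ + p₂ * s₁) = A₁ := by
    apply mul_right_cancel₀ hG0
    linear_combination E1 + (p₁ * s₂ + p₂ * s₁) * c0
  have c2 : c * (p₁ * p₂) = A₂ := by
    apply mul_right_cancel₀ hG0
    linear_combination E2 + (p₁ * p₂) * c0
  have hc0 : c ≠ 0 := by
    rintro h
    rw [h, zero_mul] at c0
    exact hA c0.symm
  have key : ∀ G A : F[X], c * G = A → A.natDegree ≤ D → G.natDegree ≤ D := by
    intro G A h hd
    by_cases hG : G = 0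
    · simp [hG]
    · rw [← h, natDegree_mul hc0 hG] at hd
      omega
  have k0 := key _ _ c0 d0
  have k1 := key _ _ c1 d1
  have k2 := key _ _ c2 d2
  by_contra hlt
  push Not at hlt
  have z0 := coeff_eq_zero_of_natDegree_lt (lt_of_le_of_lt k0 hlt)
  have z1 := coeff_eq_zero_of_natDegree_lt (lt_of_le_of_lt k1 hlt)
  have z2 := coeff_eq_zero_of_natDegree_lt (lt_of_le_of_lt k2 hlt)
  have b1 : p₁.natDegree ≤ rht r₁ := le_max_left _ _
  have b2 : s₁.natDegree ≤ rht r₁ := le_max_right _ _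
  have b3 : p₂.natDegree ≤ rht r₂ := le_max_left _ _
  have b4 : s₂.natDegree ≤ rht r₂ := le_max_right _ _
  rw [coeff_mul_add_eq_of_natDegree_le b2 b4] at z0
  rw [coeff_mul_add_eq_of_natDegree_le b1 b3] at z2
  rw [coeff_add, coeff_mul_add_eq_of_natDegree_le b1 b4, add_comm (rht r₁),
    coeff_mul_add_eq_of_natDegree_le b3 b2] at z1
  have m1 : p₁.coeff (rht r₁) ≠ 0 ∨ s₁.coeff (rht r₁) ≠ 0 := coeff_max_ne p₁ s₁ hs1n
  have m2 : p₂.coeff (rht r₂) ≠ 0 ∨ s₂.coeff (rht r₂) ≠ 0 := coeff_max_ne p₂ s₂ hs2n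
  exact four_aux m1 m2 z0 z1 z2

end HeightLemmas

section CurveLemmas
open Polynomial WeierstrassCurve.Affine

/-- The Weierstrass curve `y² = x³ + A g x² + B g² x + C g³`, the twist by `g`. -/
def tw {K : Type*} [Field K] (g A B C : K) : WeierstrassCurve.Affine K :=
  { a₁ := 0, a₂ := A * g, a₃ := 0, a₄ := B * g ^ 2, a₆ := C * g ^ 3 }

lemma tw_eq {K : Type*} [Field K] {g A B C r y : K}
    (h : (tw g A B C).Equation (g * r) y) : y ^ 2 = g ^ 3 * (r ^ 3 + A * r ^ 2 + B * r + C) := by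
  rw [equation_iff] at h
  simp only [tw] at h
  linear_combination h

lemma tw_nonsing {K : Type*} [Field K] {g A B C r y : K} (h2 : (2 : K) ≠ 0) (hy : y ≠ 0)
    (h : y ^ 2 = g ^ 3 * (r ^ 3 + A * r ^ 2 + B * r + C)) : (tw g A B C).Nonsingular (g * r) y := by
  rw [nonsingular_iff', equation_iff]
  simp only [tw]
  refine ⟨by linear_combination h, Or.inr ?_⟩
  simpa using ⟨h2, hy⟩

lemma tw_add {K : Type*} [Field K] {g A B C r t y₁ y₂ : K} (hg : g ≠ 0) (hrt : r ≠ t)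
    (h₁ : (tw g A B C).Nonsingular (g * r) y₁) (h₂ : (tw g A B C).Nonsingular (g * t) y₂) :
    ∃ r' y', ∃ h' : (tw g A B C).Nonsingular (g * r') y',
      Point.some _ _ h₁ + Point.some _ _ h₂ = Point.some _ _ h' ∧
      r' * (g ^ 3 * (r - t) ^ 2) = (y₁ - y₂) ^ 2 - g ^ 3 * (r - t) ^ 2 * (A + r + t) := by
  have hx : g * r ≠ g * t := fun h => hrt (mul_left_cancel₀ hg h)
  have hrt' : r - t ≠ 0 := sub_ne_zero.2 hrt
  have e := Point.add_of_X_ne (h₁ := h₁) (h₂ := h₂) hx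
  have key : ∀ x y (h : (tw g A B C).Nonsingular x y),
      x = (tw g A B C).addX (g * r) (g * t) ((tw g A B C).slope (g * r) (g * t) y₁ y₂) →
      ∃ r' y', ∃ h' : (tw g A B C).Nonsingular (g * r') y',
      Point.some _ _ h = Point.some _ _ h' ∧
      r' * (g ^ 3 * (r - t) ^ 2) = (y₁ - y₂) ^ 2 - g ^ 3 * (r - t) ^ 2 * (A + r + t) := by
    intro x y h hxe
    have hxg : x = g * (x / g) := by field_simp
    refine ⟨x / g, y, hxg ▸ h, ?_, ?_⟩
    · congr 1
    · rw [hxe, slope_of_X_ne hx]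
      simp only [addX, tw]
      rw [← mul_sub]
      field_simp
      ring
  rw [e]
  exact key _ _ _ rfl

lemma tw_neg {K : Type*} [Field K] {g A B C x y : K}
    (h : (tw g A B C).Nonsingular x y) : ∃ h' : (tw g A B C).Nonsingular x (-y),
      -Point.some _ _ h = Point.some _ _ h' := by
  have e : (tw g A B C).negY x y = -y := by simp [negY, tw]
  have h' : (tw g A B C).Nonsingular x (-y) := by
    rw [← e]; exact (nonsingular_neg ..).mpr h
  refine ⟨h', ?_⟩
  rw [Point.neg_some]
  congr 1

lemma tw_dbl {K : Type*} [Field K] {g A B C t y : K} (hg : g ≠ 0) (hy : y ≠ 0) (h2 : (2 : K) ≠ 0)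
    (h : (tw g A B C).Nonsingular (g * t) y) (hy2 : y ^ 2 = g ^ 4) :
    ∃ r' y', ∃ h' : (tw g A B C).Nonsingular (g * r') y',
      Point.some _ _ h + Point.some _ _ h = Point.some _ _ h' ∧
      r' * (4 * g) = (3 * t ^ 2 + 2 * A * t + B) ^ 2 - 4 * g * (A + 2 * t) := by
  have hne : y ≠ (tw g A B C).negY (g * t) y := by
    simp only [negY, tw]
    intro hh
    have : 2 * y = 0 := by linear_combination hh
    exact (mul_ne_zero h2 hy) this
  have e := Point.add_self_of_Y_ne (h₁ := h) hne
  have key : ∀ x z (h : (tw g A B C).Nonsingular x z),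
      x = (tw g A B C).addX (g * t) (g * t) ((tw g A B C).slope (g * t) (g * t) y y) →
      ∃ r' y', ∃ h' : (tw g A B C).Nonsingular (g * r') y',
      Point.some _ _ h = Point.some _ _ h' ∧
      r' * (4 * g) = (3 * t ^ 2 + 2 * A * t + B) ^ 2 - 4 * g * (A + 2 * t) := by
    intro x z h hxe
    have hxg : x = g * (x / g) := by field_simp
    refine ⟨x / g, z, hxg ▸ h, ?_, ?_⟩
    · congr 1
    · have hs : (tw g A B C).slope (g * t) (g * t) y y
          = g ^ 2 * (3 * t ^ 2 + 2 * A * t + B) / (2 * y) := by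
        rw [slope_of_Y_ne rfl hne]
        simp only [negY, tw]
        congr 1 <;> ring
      rw [hxe, hs]
      simp only [addX, tw]
      have : (g ^ 2 * (3 * t ^ 2 + 2 * A * t + B) / (2 * y)) ^ 2
          = (3 * t ^ 2 + 2 * A * t + B) ^ 2 / 4 := by
        rw [div_pow, mul_pow, mul_pow, hy2]
        have h4 : (4 : K) = 2 ^ 2 := by norm_num
        rw [h4]
        field_simp
      rw [this]
      have h4 : (4 : K) ≠ 0 := by
        have : (4 : K) = 2 * 2 := by norm_num
        rw [this]; exact mul_ne_zero h2 h2
      field_simp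
      ring
  rw [e]
  exact key _ _ _ rfl

variable {F : Type*} [Field F]

/-- height of a point on the twisted curve -/
def pht {g A B C : RatFunc F} : (tw g A B C).Point → ℕ
  | .zero => 0
  | .some x _ _ => rht (x / g)

lemma pht_zero {g A B C : RatFunc F} : pht (0 : (tw g A B C).Point) = 0 := rfl

lemma pht_some {g A B C r y : RatFunc F} (hg : g ≠ 0) (h : (tw g A B C).Nonsingular (g * r) y) :
    pht (Point.some _ _ h) = rht r := by
  change rht (g * r / g) = rht r
  rw [mul_div_cancel_left₀ _ hg]

lemma rht_X : rht (algebraMap F[X] (RatFunc F) X) = 1 := by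
  rw [rht, RatFunc.num_algebraMap, RatFunc.denom_algebraMap]
  simp

/-- the cubic -/
def cub (A B c : F) : F[X] := X ^ 3 + C A * X ^ 2 + C B * X + C c

lemma cub_natDegree (A B c : F) : (cub A B c).natDegree = 3 := by
  unfold cub; compute_degree!

lemma cub_ne (A B c : F) : cub A B c ≠ 0 := by
  intro h
  have := cub_natDegree A B c
  rw [h] at this; simp at this

local notation "am" => algebraMap F[X] (RatFunc F)

lemma para {A B c : F} (h2 : (2 : F) ≠ 0) (g : RatFunc F) (hgdef : g = am (cub A B c))
    (y₂ : RatFunc F) (hy₂ : y₂ ^ 2 = g ^ 4)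
    (hQ : (tw g (am (C A)) (am (C B)) (am (C c))).Nonsingular (g * am X) y₂)
    (P : (tw g (am (C A)) (am (C B)) (am (C c))).Point) :
    pht (P + Point.some _ _ hQ) + pht (P - Point.some _ _ hQ) ≤ 2 * pht P + 2 := by
  have hg : g ≠ 0 := by simpa [hgdef] using cub_ne A B c
  have h2K : (2 : RatFunc F) ≠ 0 := by
    rw [← map_ofNat (algebraMap F (RatFunc F)) 2]
    exact (_root_.map_ne_zero _).2 h2
  have hy0 : y₂ ≠ 0 := by
    rintro rfl
    exact hg (by simpa using hy₂.symm)
  obtain ⟨hQ', eQ'⟩ := tw_neg hQ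
  have dblbound : ∀ y (h : (tw g (am (C A)) (am (C B)) (am (C c))).Nonsingular (g * am X) y),
      y ^ 2 = g ^ 4 → pht (Point.some _ _ h + Point.some _ _ h) ≤ 4 := by
    intro y h hy
    have hy0 : y ≠ 0 := by
      rintro rfl
      exact hg (by simpa using hy.symm)
    obtain ⟨r', y', h', e1, e2⟩ := tw_dbl hg hy0 h2K h hy
    rw [e1, pht_some hg]
    have h4 : (4 : F) ≠ 0 := by
      have : (4 : F) = 2 * 2 := by norm_num
      rw [this]; exact mul_ne_zero h2 h2
    apply rht_le_of_div r' ((3 * X ^ 2 + 2 * C A * X + C B) ^ 2 - 4 * cub A B c * (C A + 2 * X))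
      (C 4 * cub A B c) (mul_ne_zero (by simpa using h4) (cub_ne A B c))
    · have : am (C 4) = 4 := by rw [map_ofNat C 4, map_ofNat]
      rw [map_mul, this, ← hgdef, e2]
      simp only [map_sub, map_mul, map_add, map_pow, map_ofNat, hgdef]
    · unfold cub
      compute_degree
    · unfold cub
      compute_degree
      norm_num
  rcases P with _ | ⟨x, y₁, hP⟩
  · rw [← Point.zero_def, zero_add, zero_sub, eQ', pht_some hg, pht_some hg, rht_X, pht_zero]
  · obtain ⟨r, rfl⟩ : ∃ r, x = g * r := ⟨x / g, by field_simp⟩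
    by_cases hr : r = am X
    · subst hr
      rw [pht_some hg, rht_X]
      rcases (Point.X_eq_iff (h₁ := hP) (h₂ := hQ)).1 rfl with h | h
      · rw [h, sub_self, pht_zero]
        exact dblbound _ hQ hy₂
      · rw [h, neg_add_cancel, pht_zero, eQ', sub_eq_add_neg, eQ']
        have := dblbound _ hQ' (by rw [neg_sq]; exact hy₂)
        omega
    · obtain ⟨rp, yp, hp, ep, fp⟩ := tw_add hg hr hP hQ
      obtain ⟨rm, ym, hm, em, fm⟩ := tw_add hg hr hP hQ'
      rw [sub_eq_add_neg, eQ', ep, em, pht_some hg, pht_some hg, pht_some hg]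
      have q1 := tw_eq hP.1
      have q2 := tw_eq hQ.1
      have hr' : r - am X ≠ 0 := sub_ne_zero.2 hr
      set p := r.num with hpd
      set s := r.denom with hsd
      have hs0 : s ≠ 0 := RatFunc.denom_ne_zero _
      have hs : am s ≠ 0 := by simpa using hs0
      have hrs : r * am s = am p := by
        have := RatFunc.num_div_denom r
        rw [div_eq_iff hs] at this
        exact this.symm
      have bp : p.natDegree ≤ rht r := le_max_left _ _
      have bs : s.natDegree ≤ rht r := le_max_right _ _
      have bX : (X : F[X]).natDegree ≤ 1 := natDegree_X_le
      have n0 : (r - am X) ^ 2 * (rp + rm) =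
          2 * ((r + am X) * (am (C B) + r * am X) + 2 * am (C A) * r * am X + 2 * am (C c)) := by
        have hg3 : g ^ 3 ≠ 0 := pow_ne_zero _ hg
        apply mul_left_cancel₀ hg3
        linear_combination fp + fm + 2 * q1 + 2 * q2
      have n1 : (r - am X) ^ 2 * (rp * rm) =
          (r * am X - am (C B)) ^ 2 - 4 * am (C c) * (r + am X + am (C A)) := by
        have hg3 : g ^ 6 * (r - am X) ^ 2 ≠ 0 := mul_ne_zero (pow_ne_zero _ hg) (pow_ne_zero _ hr')
        apply mul_left_cancel₀ hg3
        have : g ^ 6 * (r - am X) ^ 2 * ((r - am X) ^ 2 * (rp * rm)) =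
          (rp * (g ^ 3 * (r - am X) ^ 2)) * (rm * (g ^ 3 * (r - am X) ^ 2)) := by ring
        rw [this, fp, fm]
        have : ((y₁ - y₂) ^ 2 - g ^ 3 * (r - am X) ^ 2 * (am (C A) + r + am X)) *
            ((y₁ - -y₂) ^ 2 - g ^ 3 * (r - am X) ^ 2 * (am (C A) + r + am X))
          = (y₁ ^ 2 - y₂ ^ 2) ^ 2
            - 2 * (g ^ 3 * (r - am X) ^ 2 * (am (C A) + r + am X)) * (y₁ ^ 2 + y₂ ^ 2)
            + (g ^ 3 * (r - am X) ^ 2 * (am (C A) + r + am X)) ^ 2 := by ring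
        rw [this, q1, q2]
        ring
      have e1 : (p + X * s).natDegree ≤ rht r + 1 := by
        refine natDegree_add_le_of_degree_le (bp.trans (by omega)) ?_
        exact natDegree_mul_le.trans (by omega)
      have e1' : (p - X * s).natDegree ≤ rht r + 1 := by
        refine natDegree_sub_le_of_le (n := rht r + 1) (m := rht r + 1) (bp.trans (by omega)) ?_ |>.trans (by simp)
        exact natDegree_mul_le.trans (by omega)
      have e2 : (C B * s + p * X).natDegree ≤ rht r + 1 := by
        refine natDegree_add_le_of_degree_le ((natDegree_C_mul_le _ _).trans (by omega)) ?_
        exact natDegree_mul_le.trans (by omega)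
      have e2' : (p * X - C B * s).natDegree ≤ rht r + 1 := by
        refine natDegree_sub_le_of_le (n := rht r + 1) (m := rht r + 1) ?_
          ((natDegree_C_mul_le _ _).trans (by omega)) |>.trans (by simp)
        exact natDegree_mul_le.trans (by omega)
      apply rht_add_le rp rm ((p - X * s) ^ 2)
        (C 2 * ((p + X * s) * (C B * s + p * X) + C (2 * A) * (p * (X * s)) + C (2 * c) * (s * s)))
        ((p * X - C B * s) ^ 2 - C (4 * c) * (s * (p + X * s + C A * s)))
      · apply pow_ne_zero
        intro h
        apply hr'
        apply mul_right_cancel₀ hs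
        have := congrArg am h
        simp only [map_sub, map_mul, map_zero] at this
        linear_combination this + hrs
      · exact natDegree_pow_le.trans (by omega)
      · refine (natDegree_C_mul_le _ _).trans ?_
        refine natDegree_add_le_of_degree_le (natDegree_add_le_of_degree_le ?_ ?_) ?_
        · exact natDegree_mul_le.trans (by omega)
        · refine (natDegree_C_mul_le _ _).trans ?_
          have := natDegree_mul_le (p := X) (q := s)
          exact natDegree_mul_le.trans (by omega)
        · refine (natDegree_C_mul_le _ _).trans ?_
          exact natDegree_mul_le.trans (by omega)
      · refine (natDegree_sub_le _ _).trans (max_le ?_ ?_)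
        · exact natDegree_pow_le.trans (by omega)
        · refine (natDegree_C_mul_le _ _).trans ?_
          have : (p + X * s + C A * s).natDegree ≤ rht r + 1 :=
            natDegree_add_le_of_degree_le e1 ((natDegree_C_mul_le _ _).trans (by omega))
          exact natDegree_mul_le.trans (by omega)
      · simp only [map_sub, map_mul, map_add, map_pow, map_ofNat, map_ofNat C, map_ofNat am, ← hrs]
        linear_combination (am s) ^ 2 * n0
      · simp only [map_sub, map_mul, map_add, map_pow, map_ofNat, map_ofNat C, map_ofNat am, ← hrs]
        linear_combination (am s) ^ 2 * n1

end CurveLemmas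

section HasseBound
open Polynomial WeierstrassCurve.Affine

variable {F : Type*} [Field F] [Fintype F]

local notation "am" => algebraMap F[X] (RatFunc F)

lemma cub_pow_card (A B c : F) (hF : ringChar F ≠ 2) :
    cub A B c * (cub A B c ^ (Fintype.card F / 2)) ^ 2
      = X ^ (3 * Fintype.card F) + C A * X ^ (2 * Fintype.card F) + C B * X ^ Fintype.card F + C c := by
  have h1 : cub A B c * (cub A B c ^ (Fintype.card F / 2)) ^ 2 = cub A B c ^ Fintype.card F := by
    rw [← pow_mul, ← pow_succ']
    congr 1
    have := FiniteField.odd_card_of_char_ne_two hF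
    omega
  rw [h1, ← FiniteField.expand_card]
  simp only [cub, map_add, map_mul, map_pow, expand_X, expand_C]
  ring

/-- numerator polynomial -/
def numN (A B c : F) (e : F) : F[X] :=
  cub A B c * (cub A B c ^ (Fintype.card F / 2) - C e) ^ 2
    - (C A + X ^ Fintype.card F + X) * (X ^ Fintype.card F - X) ^ 2

lemma numN_natDegree (A B c e : F) (he : e ^ 2 = 1) (hF : ringChar F ≠ 2) :
    (numN A B c e).natDegree ≤ 2 * Fintype.card F + 1 := by
  have h := cub_pow_card A B c hF
  have hodd := FiniteField.odd_card_of_char_ne_two hF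
  have hq1 : 1 < Fintype.card F := Fintype.one_lt_card
  set q := Fintype.card F with hq
  have hq3 : 3 ≤ q := by omega
  have hC : (C e : F[X]) ^ 2 = 1 := by rw [← C_pow, he, C_1]
  have e1 : numN A B c e = (C B * X ^ q + C c + cub A B c - X ^ 3 - C A * X ^ 2
      + X ^ (2 * q + 1) + X ^ (q + 2) + C 2 * C A * X ^ (q + 1))
      - C (2 * e) * cub A B c ^ (q / 2 + 1) := by
    have c2 : (C 2 : F[X]) = 2 := map_ofNat C 2
    rw [numN, ← hq, C_mul, c2]
    have x3 : (X : F[X]) ^ (3 * q) = (X ^ q) ^ 3 := by rw [← pow_mul, mul_comm]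
    have x2 : (X : F[X]) ^ (2 * q) = (X ^ q) ^ 2 := by rw [← pow_mul, mul_comm]
    rw [x3, x2] at h
    rw [pow_succ, pow_succ, pow_add, pow_succ X q, x2]
    linear_combination h + cub A B c * hC
  rw [e1]
  refine (natDegree_sub_le _ _).trans (max_le ?_ ?_)
  · unfold cub
    compute_degree
    simp only [max_le_iff]
    omega
  · refine (natDegree_C_mul_le _ _).trans (natDegree_pow_le.trans ?_)
    rw [cub_natDegree]
    omega

lemma exists_G (A B c : F) (hF : ringChar F ≠ 2) (ε : ℤ) (hε : ε = 1 ∨ ε = -1) :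
    ∃ G : F[X], G ∣ numN A B c (ε : F) ∧ G ∣ (X ^ Fintype.card F - X) ^ 2 ∧
      (G.natDegree : ℤ) = Fintype.card F + ε * ∑ x : F, quadraticChar F ((cub A B c).eval x) := by
  set m : F → ℕ := fun r => (1 + ε * quadraticChar F ((cub A B c).eval r)).toNat with hm
  have hmZ : ∀ r, (m r : ℤ) = 1 + ε * quadraticChar F ((cub A B c).eval r) := by
    intro r
    rw [hm]; dsimp only
    apply Int.toNat_of_nonneg
    by_cases h0 : (cub A B c).eval r = 0
    · rw [h0, quadraticChar_zero]; norm_num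
    · rcases quadraticChar_dichotomy h0 with h | h <;> rcases hε with h' | h' <;> rw [h, h'] <;> norm_num
  have hcop : Set.Pairwise (↑(univ : Finset F) : Set F)
      (Function.onFun IsCoprime fun r => (X - C r) ^ m r) := by
    intro x _ y _ hxy
    exact (isCoprime_X_sub_C_of_isUnit_sub (sub_ne_zero.2 hxy).isUnit).pow
  have hlin : ∀ r : F, (X - C r) ∣ (X ^ Fintype.card F - X : F[X]) := by
    intro r
    rw [dvd_iff_isRoot, IsRoot.def]
    simp [FiniteField.pow_card]
  have hcase : ∀ r : F, m r ≤ 2 ∧ (X - C r) ^ m r ∣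
      cub A B c * (cub A B c ^ (Fintype.card F / 2) - C (ε : F)) ^ 2 := by
    intro r
    have h1 := hmZ r
    by_cases h0 : (cub A B c).eval r = 0
    · rw [h0, quadraticChar_zero] at h1
      have : m r = 1 := by omega
      rw [this, pow_one]
      exact ⟨by norm_num, Dvd.dvd.mul_right (dvd_iff_isRoot.2 h0) _⟩
    · have hp := quadraticChar_eq_pow_of_char_ne_two' hF ((cub A B c).eval r)
      by_cases hh : ε = quadraticChar F ((cub A B c).eval r)
      · have : m r = 2 := by
          rw [← hh] at h1
          rcases hε with h' | h' <;> rw [h'] at h1 <;> omega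
        rw [this]
        refine ⟨le_rfl, Dvd.dvd.mul_left (pow_dvd_pow_of_dvd ?_ 2) _⟩
        rw [dvd_iff_isRoot, IsRoot.def]
        simp only [eval_sub, eval_pow, eval_C]
        rw [← hp, ← hh, sub_self]
      · have : m r = 0 := by
          rcases quadraticChar_dichotomy h0 with h | h <;> rcases hε with h' | h' <;>
            rw [h, h'] at hh h1 <;> omega
        rw [this]; simp
  have hG2 : (∏ r : F, (X - C r) ^ m r) ∣ (X ^ Fintype.card F - X) ^ 2 := by
    apply Finset.prod_dvd_of_coprime hcop
    intro r _
    exact (pow_dvd_pow _ (hcase r).1).trans (pow_dvd_pow_of_dvd (hlin r) 2)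
  refine ⟨∏ r : F, (X - C r) ^ m r, ?_, hG2, ?_⟩
  · apply dvd_sub
    · apply Finset.prod_dvd_of_coprime hcop
      intro r _
      exact (hcase r).2
    · exact Dvd.dvd.mul_left hG2 _
  · rw [natDegree_prod_of_monic _ _ (fun r _ => (monic_X_sub_C r).pow _)]
    simp only [natDegree_pow, natDegree_X_sub_C, mul_one]
    push_cast
    simp only [hmZ]
    rw [Finset.sum_add_distrib, ← Finset.mul_sum]
    simp

lemma hasse_aux (A B c : F) (hF : ringChar F ≠ 2) (ε : ℤ) (hε : ε = 1 ∨ ε = -1) (n : ℕ) :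
    0 ≤ (n : ℤ) ^ 2 - (ε * ∑ x : F, quadraticChar F ((cub A B c).eval x)) * n
      + Fintype.card F := by
  have h2 : (2 : F) ≠ 0 := Ring.two_ne_zero hF
  have hodd := FiniteField.odd_card_of_char_ne_two hF
  have hq1 : 1 < Fintype.card F := Fintype.one_lt_card
  have h2K : (2 : RatFunc F) ≠ 0 := by
    rw [← map_ofNat (algebraMap F (RatFunc F)) 2]
    exact (_root_.map_ne_zero _).2 h2
  set q := Fintype.card F with hq
  set S := ∑ x : F, quadraticChar F ((cub A B c).eval x) with hS
  obtain ⟨g, hgdef⟩ : ∃ g, g = am (cub A B c) := ⟨_, rfl⟩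
  have hg : g ≠ 0 := by rw [hgdef]; simpa using cub_ne A B c
  have heF : (ε : F) ^ 2 = 1 := by rcases hε with h | h <;> rw [h] <;> norm_num
  have heK : am (C (ε : F)) ^ 2 = 1 := by rw [← map_pow, ← C_pow, heF, C_1, map_one]
  set E := am (C (ε : F)) with hE
  have hE0 : E ≠ 0 := by rintro h; rw [h] at heK; norm_num at heK
  have hgX : g = am X ^ 3 + am (C A) * am X ^ 2 + am (C B) * am X + am (C c) := by
    rw [hgdef, cub]; simp only [map_add, map_mul, map_pow]
  have hQ : (tw g (am (C A)) (am (C B)) (am (C c))).Nonsingular (g * am X) (g ^ 2 * E) := by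
    apply tw_nonsing h2K (mul_ne_zero (pow_ne_zero _ hg) hE0)
    rw [← hgX]
    linear_combination g ^ 4 * heK
  have hP : (tw g (am (C A)) (am (C B)) (am (C c))).Nonsingular (g * am X ^ q)
      (g ^ 2 * g ^ (q / 2)) := by
    apply tw_nonsing h2K (mul_ne_zero (pow_ne_zero _ hg) (pow_ne_zero _ hg))
    have := congrArg am (cub_pow_card A B c hF)
    rw [← hq] at this
    simp only [map_mul, map_pow, map_add, ← hgdef] at this
    have x3 : (am X) ^ (3 * q) = (am X ^ q) ^ 3 := by rw [← pow_mul, mul_comm]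
    have x2 : (am X) ^ (2 * q) = (am X ^ q) ^ 2 := by rw [← pow_mul, mul_comm]
    rw [x3, x2] at this
    linear_combination g ^ 3 * this
  set P := Point.some _ _ hP with hPd
  set Q := Point.some _ _ hQ with hQd
  have hX : am X ^ q ≠ am X := by
    intro h
    rw [← map_pow] at h
    have := RatFunc.algebraMap_injective F h
    have := congrArg natDegree this
    simp at this
    omega
  have h0 : pht P = q := by
    rw [hPd, pht_some hg, ← map_pow, rht, RatFunc.num_algebraMap, RatFunc.denom_algebraMap]
    simp
  have h1 : (pht (P + Q) : ℤ) ≤ q + 1 - ε * S := by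
    obtain ⟨r', y', h', e1, e2⟩ := tw_add hg hX hP hQ
    rw [hPd, hQd, e1, pht_some hg]
    obtain ⟨G, ⟨N', hN'⟩, ⟨D', hD'⟩, hGd⟩ := exists_G A B c hF ε hε
    rw [← hq] at hD' hGd
    rw [← hS] at hGd
    have hXq : (X ^ q - X : F[X]).natDegree = q := FiniteField.X_pow_card_sub_X_natDegree_eq F hq1
    have hXq0 : (X ^ q - X : F[X]) ≠ 0 := FiniteField.X_pow_card_sub_X_ne_zero F hq1
    have hGD : G * D' ≠ 0 := by rw [← hD']; exact pow_ne_zero _ hXq0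
    have hG0 := left_ne_zero_of_mul hGD
    have hD0 := right_ne_zero_of_mul hGD
    have d1 : G.natDegree + D'.natDegree = 2 * q := by
      rw [← natDegree_mul hG0 hD0, ← hD', natDegree_pow, hXq]
    have d2 : N'.natDegree ≤ 2 * q + 1 - G.natDegree := by
      by_cases hN0 : N' = 0
      · rw [hN0]; simp
      · have := numN_natDegree A B c (ε : F) heF hF
        rw [hN', natDegree_mul hG0 hN0] at this
        omega
    have : rht r' ≤ 2 * q + 1 - G.natDegree := by
      apply rht_le_of_div r' N' D' hD0 _ ?_ d2 (by omega)
      have hGm : am G ≠ 0 := by simpa using hG0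
      apply mul_left_cancel₀ hGm
      rw [← map_mul, ← hN']
      have t1 : am G * (r' * am D') = r' * am ((X ^ q - X) ^ 2) := by
        rw [hD', map_mul]; ring
      rw [t1]
      apply mul_left_cancel₀ (pow_ne_zero 3 hg)
      rw [numN]
      simp only [map_mul, map_pow, map_add, map_sub, ← hgdef, ← hE, ← hq]
      linear_combination e2
    omega
  have hrec : ∀ n : ℕ, pht (P + (n + 2) • Q) + pht (P + n • Q) ≤ 2 * pht (P + (n + 1) • Q) + 2 := by
    intro n
    have := para h2 g hgdef (g ^ 2 * E) (by rw [mul_pow, heK]; ring) hQ (P + (n + 1) • Q)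
    rw [← hQd] at this
    have t1 : P + (n + 1) • Q + Q = P + (n + 2) • Q := by rw [add_assoc, ← succ_nsmul]
    have t2 : P + (n + 1) • Q - Q = P + n • Q := by rw [succ_nsmul]; abel
    rwa [t1, t2] at this
  have key : ∀ n : ℕ, ((pht (P + (n + 1) • Q) : ℤ) - pht (P + n • Q) ≤ 2 * n + 1 - ε * S) ∧
      (pht (P + n • Q) : ℤ) ≤ n ^ 2 - ε * S * n + q := by
    intro n
    induction n with
    | zero =>
      rw [zero_nsmul, add_zero, zero_add, one_nsmul, h0]
      push_cast
      constructor <;> linarith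
    | succ n ih =>
      have := hrec n
      zify at this
      push_cast
      constructor
      · linarith [ih.1]
      · nlinarith [ih.1, ih.2]
  have := (key n).2
  linarith [Int.natCast_nonneg (pht (P + n • Q))]

lemma hasse_bound (A B c : F) (hF : ringChar F ≠ 2) :
    (∑ x : F, quadraticChar F (x ^ 3 + A * x ^ 2 + B * x + c)) ^ 2 ≤ 4 * (Fintype.card F : ℤ) := by
  have hodd := FiniteField.odd_card_of_char_ne_two hF
  have aux := hasse_aux A B c hF
  have e : ∀ x : F, (cub A B c).eval x = x ^ 3 + A * x ^ 2 + B * x + c := by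
    intro x; simp [cub]
  simp only [e] at aux
  generalize (∑ x : F, quadraticChar F (x ^ 3 + A * x ^ 2 + B * x + c)) = S at *
  have main : ∀ s : ℕ, (∀ n : ℕ, 0 ≤ (n : ℤ) ^ 2 - s * n + Fintype.card F) →
      (s : ℤ) ^ 2 ≤ 4 * (Fintype.card F : ℤ) := by
    intro s hs
    rcases Nat.even_or_odd' s with ⟨k, rfl | rfl⟩
    · have := hs k
      push_cast at this ⊢
      nlinarith
    · have := hs k
      push_cast at this ⊢
      obtain ⟨j, hj⟩ : ∃ j, Fintype.card F = 2 * j + 1 := ⟨Fintype.card F / 2, by omega⟩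
      rw [hj] at this ⊢
      push_cast at this ⊢
      obtain ⟨i, hi⟩ := Nat.even_or_odd' (k * k + k)
      have hi' : k * k + k = 2 * i := by
        rcases hi with h | h
        · exact h
        · exfalso
          have : Even (k * (k + 1)) := Nat.even_mul_succ_self k
          rw [mul_add, mul_one, h] at this
          simp at this
      zify at hi'
      have : (2 * i : ℤ) ≤ 2 * j + 1 := by nlinarith
      have : (i : ℤ) ≤ j := by omega
      nlinarith
  rcases le_total 0 S with h | h
  · lift S to ℕ using h
    apply main
    intro n
    have := aux 1 (Or.inl rfl) n
    rwa [one_mul] at this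
  · obtain ⟨s, rfl⟩ : ∃ s : ℕ, S = -s := ⟨(-S).toNat, by omega⟩
    rw [neg_sq]
    apply main
    intro n
    have := aux (-1) (Or.inr rfl) n
    rwa [neg_one_mul, neg_neg] at this

end HasseBound

section CharSums

variable {F : Type*} [Field F] [Fintype F]

local notation "χ" => quadraticChar F

lemma chi_vals (x : F) : χ x = 0 ∨ χ x = 1 ∨ χ x = -1 := by
  by_cases h : x = 0
  · left; rw [h, quadraticChar_zero]
  · right; exact quadraticChar_dichotomy h

lemma sum_inv_chi (h : F → ℤ) :
    ∑ x : F, (if x = 0 then 0 else h x⁻¹) = ∑ y : F, h y - h 0 := by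
  have h1 : ∑ x : F, (if x = 0 then 0 else h x⁻¹) = ∑ y : F, (if y = 0 then 0 else h y) := by
    rw [← Equiv.sum_comp (Function.Involutive.toPerm (fun x : F => x⁻¹) inv_inv)
      (fun y => if y = 0 then 0 else h y)]
    apply Finset.sum_congr rfl
    intro x _
    simp [Function.Involutive.toPerm]
  rw [h1]
  have h2 : ∀ y : F, (if y = 0 then 0 else h y) = h y - (if y = 0 then h y else 0) := by
    intro y; split_ifs <;> ring
  simp only [h2, Finset.sum_sub_distrib]
  simp

lemma chi_sq_mul {x : F} (hx : x ≠ 0) (y : F) : χ (x * x * y) = χ y := by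
  rw [map_mul, map_mul]
  have := quadraticChar_sq_one hx
  rw [pow_two] at this
  rw [this, one_mul]

lemma chi_T1 (hF : ringChar F ≠ 2) (e : F) : ∑ x : F, χ (x - e) = 0 := by
  rw [← quadraticChar_sum_zero hF]
  exact Equiv.sum_comp (Equiv.subRight e) (fun x => χ x)

lemma chi_T2 (hF : ringChar F ≠ 2) {e e' : F} (he : e ≠ e') :
    ∑ x : F, χ (x - e) * χ (x - e') = -1 := by
  have hd : e - e' ≠ 0 := sub_ne_zero.2 he
  have h1 : ∑ x : F, χ (x - e) * χ (x - e') = ∑ x : F, χ x * χ (x + (e - e')) := by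
    rw [← Equiv.sum_comp (Equiv.subRight e) (fun x => χ x * χ (x + (e - e')))]
    apply Finset.sum_congr rfl
    intro x _
    simp only [Equiv.subRight_apply]
    rw [sub_add_sub_cancel]
  rw [h1]
  set d := e - e'
  have h2 : ∀ x : F, χ x * χ (x + d) = if x = 0 then 0 else χ (1 + d * x⁻¹) := by
    intro x
    split_ifs with h
    · rw [h, quadraticChar_zero, zero_mul]
    · rw [← map_mul, ← chi_sq_mul h (1 + d * x⁻¹)]
      congr 1
      field_simp
  simp only [h2]
  rw [sum_inv_chi (fun y => χ (1 + d * y))]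
  have h3 : ∀ y : F, χ (1 + d * y) = χ d * χ (y - (-d⁻¹)) := by
    intro y
    rw [← map_mul]
    congr 1
    field_simp
    ring
  rw [Finset.sum_congr rfl (fun y _ => h3 y), ← Finset.mul_sum, chi_T1 hF]
  simp

lemma chi_T3 (hF : ringChar F ≠ 2) (e₁ e₂ e₃ : F) :
    |((∑ x : F, χ (x - e₁) * χ (x - e₂) * χ (x - e₃) : ℤ) : ℝ)| ≤ 2 * √(Fintype.card F) := by
  have h := hasse_bound (-(e₁ + e₂ + e₃)) (e₁ * e₂ + e₁ * e₃ + e₂ * e₃) (-(e₁ * e₂ * e₃)) hF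
  have h1 : ∀ x : F, χ (x ^ 3 + -(e₁ + e₂ + e₃) * x ^ 2 + (e₁ * e₂ + e₁ * e₃ + e₂ * e₃) * x
      + -(e₁ * e₂ * e₃)) = χ (x - e₁) * χ (x - e₂) * χ (x - e₃) := by
    intro x
    rw [← map_mul, ← map_mul]
    congr 1
    ring
  simp only [h1] at h
  apply abs_le_of_sq_le_sq _ (by positivity)
  rw [mul_pow, Real.sq_sqrt (by positivity)]
  have : ((∑ x : F, χ (x - e₁) * χ (x - e₂) * χ (x - e₃) : ℤ) : ℝ) ^ 2
    ≤ ((4 * (Fintype.card F : ℤ) : ℤ) : ℝ) := by exact_mod_cast h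
  push_cast at this ⊢
  linarith

lemma chi_T4 (hF : ringChar F ≠ 2) {e₁ e₂ e₃ e₄ : F} (h12 : e₁ ≠ e₂) (h13 : e₁ ≠ e₃)
    (h14 : e₁ ≠ e₄) :
    |((∑ x : F, χ (x - e₁) * χ (x - e₂) * χ (x - e₃) * χ (x - e₄) : ℤ) : ℝ)|
      ≤ 2 * √(Fintype.card F) + 1 := by
  have h2' : e₁ - e₂ ≠ 0 := sub_ne_zero.2 h12
  have h3' : e₁ - e₃ ≠ 0 := sub_ne_zero.2 h13
  have h4' : e₁ - e₄ ≠ 0 := sub_ne_zero.2 h14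
  have h1 : ∑ x : F, χ (x - e₁) * χ (x - e₂) * χ (x - e₃) * χ (x - e₄)
      = ∑ x : F, χ x * χ (x + (e₁ - e₂)) * χ (x + (e₁ - e₃)) * χ (x + (e₁ - e₄)) := by
    rw [← Equiv.sum_comp (Equiv.subRight e₁)
      (fun x => χ x * χ (x + (e₁ - e₂)) * χ (x + (e₁ - e₃)) * χ (x + (e₁ - e₄)))]
    apply Finset.sum_congr rfl
    intro x _
    simp only [Equiv.subRight_apply]
    rw [sub_add_sub_cancel, sub_add_sub_cancel, sub_add_sub_cancel]
  rw [h1]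
  set d₂ := e₁ - e₂
  set d₃ := e₁ - e₃
  set d₄ := e₁ - e₄
  have h2 : ∀ x : F, χ x * χ (x + d₂) * χ (x + d₃) * χ (x + d₄)
      = if x = 0 then 0 else χ ((1 + d₂ * x⁻¹) * (1 + d₃ * x⁻¹) * (1 + d₄ * x⁻¹)) := by
    intro x
    split_ifs with h
    · rw [h, quadraticChar_zero]; ring
    · rw [← map_mul, ← map_mul, ← map_mul,
        ← chi_sq_mul h ((1 + d₂ * x⁻¹) * (1 + d₃ * x⁻¹) * (1 + d₄ * x⁻¹)),
        ← chi_sq_mul h (x * x * _)]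
      congr 1
      field_simp
  simp only [h2]
  rw [sum_inv_chi (fun y => χ ((1 + d₂ * y) * (1 + d₃ * y) * (1 + d₄ * y)))]
  have h3 : ∀ y : F, χ ((1 + d₂ * y) * (1 + d₃ * y) * (1 + d₄ * y))
      = χ (d₂ * d₃ * d₄) * (χ (y - (-d₂⁻¹)) * χ (y - (-d₃⁻¹)) * χ (y - (-d₄⁻¹))) := by
    intro y
    rw [← map_mul, ← map_mul, ← map_mul]
    congr 1
    field_simp
    ring
  rw [Finset.sum_congr rfl (fun y _ => h3 y), ← Finset.mul_sum]
  have hb := chi_T3 hF (-d₂⁻¹) (-d₃⁻¹) (-d₄⁻¹)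
  generalize (∑ x : F, χ (x - (-d₂⁻¹)) * χ (x - (-d₃⁻¹)) * χ (x - (-d₄⁻¹))) = T at *
  have hz : χ ((1 + d₂ * 0) * (1 + d₃ * 0) * (1 + d₄ * 0)) = 1 := by simp
  rw [hz]
  rw [abs_le] at hb ⊢
  rcases quadraticChar_dichotomy (mul_ne_zero (mul_ne_zero h2' h3') h4') with h | h <;> rw [h] <;>
    push_cast <;> constructor <;> linarith [hb.1, hb.2]

lemma int_box (s₁ s₂ s₃ s₄ : ℤ) (h₁ : s₁ = 0 ∨ s₁ = 1 ∨ s₁ = -1) (h₂ : s₂ = 0 ∨ s₂ = 1 ∨ s₂ = -1)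
    (h₃ : s₃ = 0 ∨ s₃ = 1 ∨ s₃ = -1) (h₄ : s₄ = 0 ∨ s₄ = 1 ∨ s₄ = -1) :
    (16 * (if s₁ = 1 ∧ s₂ = 1 ∧ s₃ ≠ 1 ∧ s₄ ≠ 1 then 1 else 0)
        - (1 + s₁) * (1 + s₂) * (1 - s₃) * (1 - s₄)
      ≤ (if s₃ = 0 then 8 else 0) + (if s₄ = 0 then 8 else 0)) ∧
    (-((if s₁ = 0 then 8 else 0) + (if s₂ = 0 then 8 else 0)) ≤
      16 * (if s₁ = 1 ∧ s₂ = 1 ∧ s₃ ≠ 1 ∧ s₄ ≠ 1 then 1 else 0)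
        - (1 + s₁) * (1 + s₂) * (1 - s₃) * (1 - s₄)) := by
  rcases h₁ with rfl | rfl | rfl <;> rcases h₂ with rfl | rfl | rfl <;>
    rcases h₃ with rfl | rfl | rfl <;> rcases h₄ with rfl | rfl | rfl <;> norm_num

lemma inR_iff (x : F) : inR x ↔ χ x = 1 := by
  unfold inR
  constructor
  · rintro ⟨h0, h⟩
    exact (quadraticChar_one_iff_isSquare h0).2 h
  · intro h
    have h0 : x ≠ 0 := by
      rintro rfl
      rw [quadraticChar_zero] at h; norm_num at h
    exact ⟨h0, (quadraticChar_one_iff_isSquare h0).1 h⟩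

lemma count_bound (hF : ringChar F ≠ 2) {u₁ u₂ u₃ u₄ e₁ e₂ e₃ e₄ : F}
    (hu₁ : u₁ ≠ 0) (hu₂ : u₂ ≠ 0) (hu₃ : u₃ ≠ 0) (hu₄ : u₄ ≠ 0)
    (h12 : e₁ ≠ e₂) (h13 : e₁ ≠ e₃) (h14 : e₁ ≠ e₄)
    (h23 : e₂ ≠ e₃) (h24 : e₂ ≠ e₄) (h34 : e₃ ≠ e₄) (S : Finset F)
    (hp : ∀ x, x ∈ S ↔ inR (u₁ * (x - e₁)) ∧ inR (u₂ * (x - e₂)) ∧ ¬ inR (u₃ * (x - e₃)) ∧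
      ¬ inR (u₄ * (x - e₄))) :
    |16 * (S.card : ℝ) - Fintype.card F| ≤ 11 * √(Fintype.card F) + 22 := by
  set s₁ : F → ℤ := fun x => χ (u₁ * (x - e₁)) with hs₁
  set s₂ : F → ℤ := fun x => χ (u₂ * (x - e₂)) with hs₂
  set s₃ : F → ℤ := fun x => χ (u₃ * (x - e₃)) with hs₃
  set s₄ : F → ℤ := fun x => χ (u₄ * (x - e₄)) with hs₄
  have z₁ : ∀ x, s₁ x = 0 ↔ x = e₁ := by
    intro x; rw [hs₁]; dsimp only; rw [quadraticChar_eq_zero_iff, mul_eq_zero, sub_eq_zero]; tauto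
  have z₂ : ∀ x, s₂ x = 0 ↔ x = e₂ := by
    intro x; rw [hs₂]; dsimp only; rw [quadraticChar_eq_zero_iff, mul_eq_zero, sub_eq_zero]; tauto
  have z₃ : ∀ x, s₃ x = 0 ↔ x = e₃ := by
    intro x; rw [hs₃]; dsimp only; rw [quadraticChar_eq_zero_iff, mul_eq_zero, sub_eq_zero]; tauto
  have z₄ : ∀ x, s₄ x = 0 ↔ x = e₄ := by
    intro x; rw [hs₄]; dsimp only; rw [quadraticChar_eq_zero_iff, mul_eq_zero, sub_eq_zero]; tauto
  have hcard : (S.card : ℤ) =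
      ∑ x : F, (if s₁ x = 1 ∧ s₂ x = 1 ∧ s₃ x ≠ 1 ∧ s₄ x ≠ 1 then 1 else 0) := by
    have hS : S = univ.filter (fun x => x ∈ S) := by ext; simp
    rw [hS, Finset.card_filter]
    push_cast
    apply Finset.sum_congr rfl
    intro x _
    simp only [hp, inR_iff, hs₁, hs₂, hs₃, hs₄, ne_eq]
  set P : F → ℤ := fun x => (1 + s₁ x) * (1 + s₂ x) * (1 - s₃ x) * (1 - s₄ x) with hP
  have hbox := fun x : F => int_box (s₁ x) (s₂ x) (s₃ x) (s₄ x) (chi_vals _) (chi_vals _)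
    (chi_vals _) (chi_vals _)
  simp only [z₁, z₂, z₃, z₄] at hbox
  have up : 16 * (S.card : ℤ) - ∑ x : F, P x ≤ 16 := by
    rw [hcard, Finset.mul_sum, ← Finset.sum_sub_distrib]
    refine (Finset.sum_le_sum (fun x _ => (hbox x).1)).trans ?_
    rw [Finset.sum_add_distrib]; simp
  have lo : -16 ≤ 16 * (S.card : ℤ) - ∑ x : F, P x := by
    rw [hcard, Finset.mul_sum, ← Finset.sum_sub_distrib]
    refine le_trans ?_ (Finset.sum_le_sum (fun x _ => (hbox x).2))
    rw [Finset.sum_neg_distrib, Finset.sum_add_distrib]; simp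
  have hexp : ∀ x : F, P x = 1 + χ u₁ * χ (x - e₁) + χ u₂ * χ (x - e₂) - χ u₃ * χ (x - e₃)
      - χ u₄ * χ (x - e₄)
      + (χ u₁ * χ u₂) * (χ (x - e₁) * χ (x - e₂)) - (χ u₁ * χ u₃) * (χ (x - e₁) * χ (x - e₃))
      - (χ u₁ * χ u₄) * (χ (x - e₁) * χ (x - e₄)) - (χ u₂ * χ u₃) * (χ (x - e₂) * χ (x - e₃))
      - (χ u₂ * χ u₄) * (χ (x - e₂) * χ (x - e₄)) + (χ u₃ * χ u₄) * (χ (x - e₃) * χ (x - e₄))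
      - (χ u₁ * χ u₂ * χ u₃) * (χ (x - e₁) * χ (x - e₂) * χ (x - e₃))
      - (χ u₁ * χ u₂ * χ u₄) * (χ (x - e₁) * χ (x - e₂) * χ (x - e₄))
      + (χ u₁ * χ u₃ * χ u₄) * (χ (x - e₁) * χ (x - e₃) * χ (x - e₄))
      + (χ u₂ * χ u₃ * χ u₄) * (χ (x - e₂) * χ (x - e₃) * χ (x - e₄))
      + (χ u₁ * χ u₂ * χ u₃ * χ u₄) * (χ (x - e₁) * χ (x - e₂) * χ (x - e₃) * χ (x - e₄)) := by
    intro x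
    simp only [hP, hs₁, hs₂, hs₃, hs₄, map_mul]
    ring
  have hsum : ∑ x : F, P x = _ := Finset.sum_congr rfl (fun x _ => hexp x)
  simp only [Finset.sum_add_distrib, Finset.sum_sub_distrib, ← Finset.mul_sum, chi_T1 hF,
    chi_T2 hF h12, chi_T2 hF h13, chi_T2 hF h14, chi_T2 hF h23, chi_T2 hF h24, chi_T2 hF h34] at hsum
  have b1 := chi_T3 hF e₁ e₂ e₃
  have b2 := chi_T3 hF e₁ e₂ e₄
  have b3 := chi_T3 hF e₁ e₃ e₄
  have b4 := chi_T3 hF e₂ e₃ e₄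
  have b5 := chi_T4 hF h12 h13 h14
  generalize (∑ x : F, χ (x - e₁) * χ (x - e₂) * χ (x - e₃)) = A₁ at *
  generalize (∑ x : F, χ (x - e₁) * χ (x - e₂) * χ (x - e₄)) = A₂ at *
  generalize (∑ x : F, χ (x - e₁) * χ (x - e₃) * χ (x - e₄)) = A₃ at *
  generalize (∑ x : F, χ (x - e₂) * χ (x - e₃) * χ (x - e₄)) = A₄ at *
  generalize (∑ x : F, χ (x - e₁) * χ (x - e₂) * χ (x - e₃) * χ (x - e₄)) = A₅ at *
  generalize ∑ x : F, P x = SP at *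
  have hq1 : (1 : ℝ) ≤ √(Fintype.card F) := by
    rw [Real.one_le_sqrt]
    exact_mod_cast Fintype.card_pos (α := F)
  have hsumR : (SP : ℝ) = _ := congrArg (Int.cast : ℤ → ℝ) hsum
  have upR : 16 * (S.card : ℝ) - SP ≤ 16 := by exact_mod_cast up
  have loR : -16 ≤ 16 * (S.card : ℝ) - SP := by exact_mod_cast lo
  simp only [Finset.sum_const, Finset.card_univ, nsmul_eq_mul] at hsumR
  push_cast at hsumR
  rw [abs_le] at *
  rcases quadraticChar_dichotomy hu₁ with g1 | g1 <;> rcases quadraticChar_dichotomy hu₂ with g2 | g2 <;>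
  rcases quadraticChar_dichotomy hu₃ with g3 | g3 <;> rcases quadraticChar_dichotomy hu₄ with g4 | g4 <;>
  rw [g1, g2, g3, g4] at hsumR <;> push_cast at hsumR <;>
  constructor <;> linarith [b1.1, b1.2, b2.1, b2.2, b3.1, b3.2, b4.1, b4.2, b5.1, b5.2]

end CharSums

section Cycles

variable {F : Type*} [Field F] [Fintype F]

local notation "χ" => quadraticChar F

/-- the coefficient attached to a class -/
def cf (a b : F) (w : Bool) : F := if w = true then a else b

/-- pattern -/
def pat (w₁ w₂ w₃ w₄ : Bool) (k m : F) : Prop :=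
  (inR k ↔ w₁ = true) ∧ (inR (k - 1) ↔ w₂ = true) ∧ (inR m ↔ w₃ = true) ∧ (inR (m - 1) ↔ w₄ = true)

/-- `k, m` encode a transposition with given classes -/
def TT (a b : F) (w₁ w₂ w₃ w₄ : Bool) (k m : F) : Prop :=
  m ≠ k ∧ pat w₁ w₂ w₃ w₄ k m ∧
    cf a b w₁ * k = 1 + cf a b w₄ * (m - 1) ∧ cf a b w₃ * m = 1 + cf a b w₂ * (k - 1)

/-- number of `k` with given classes -/
def nn (a b : F) (w₁ w₂ w₃ w₄ : Bool) : ℕ :=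
  (univ.filter fun k : F => ∃ m, TT a b w₁ w₂ w₃ w₄ k m).card

lemma cf_ne {a b : F} (ha : a ≠ 0) (hb : b ≠ 0) (w : Bool) : cf a b w ≠ 0 := by
  unfold cf; split_ifs <;> assumption

lemma TT_swap {a b : F} {w₁ w₂ w₃ w₄ : Bool} {k m : F} (h : TT a b w₁ w₂ w₃ w₄ k m) :
    TT a b w₃ w₄ w₁ w₂ m k := by
  obtain ⟨h1, ⟨h2, h3, h4, h5⟩, h6, h7⟩ := h
  exact ⟨h1.symm, ⟨h4, h5, h2, h3⟩, h7, h6⟩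

lemma TT_fun {a b : F} (ha : a ≠ 0) (hb : b ≠ 0) {w₁ w₂ w₃ w₄ : Bool} {k m m' : F}
    (h : TT a b w₁ w₂ w₃ w₄ k m) (h' : TT a b w₁ w₂ w₃ w₄ k m') : m = m' :=
  mul_left_cancel₀ (cf_ne ha hb w₃) (h.2.2.2.trans h'.2.2.2.symm)

lemma nn_swap_le {a b : F} (ha : a ≠ 0) (hb : b ≠ 0) (w₁ w₂ w₃ w₄ : Bool) :
    nn a b w₁ w₂ w₃ w₄ ≤ nn a b w₃ w₄ w₁ w₂ := by
  unfold nn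
  have hex : ∀ k : F, ∃ m, (∃ m', TT a b w₁ w₂ w₃ w₄ k m') → TT a b w₁ w₂ w₃ w₄ k m := by
    intro k
    by_cases h : ∃ m', TT a b w₁ w₂ w₃ w₄ k m'
    · obtain ⟨m, hm⟩ := h; exact ⟨m, fun _ => hm⟩
    · exact ⟨0, fun h' => absurd h' h⟩
  choose f hf using hex
  apply Finset.card_le_card_of_injOn f
  · intro k hk
    simp only [Finset.coe_filter, Finset.mem_univ, true_and, Set.mem_ofPred_eq] at hk ⊢
    exact ⟨k, TT_swap (hf k hk)⟩
  · intro k hk k' hk' he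
    simp only [Finset.coe_filter, Finset.mem_univ, true_and, Set.mem_ofPred_eq] at hk hk'
    have h1 := TT_swap (hf k hk)
    have h2 := TT_swap (hf k' hk')
    rw [← he] at h2
    exact TT_fun ha hb h1 h2

lemma nn_swap {a b : F} (ha : a ≠ 0) (hb : b ≠ 0) (w₁ w₂ w₃ w₄ : Bool) :
    nn a b w₁ w₂ w₃ w₄ = nn a b w₃ w₄ w₁ w₂ :=
  le_antisymm (nn_swap_le ha hb _ _ _ _) (nn_swap_le ha hb _ _ _ _)

lemma phi_eq (a b x : F) (w : Bool) (h : inR x ↔ w = true) : phi a b x = cf a b w * x := by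
  unfold phi cf
  by_cases h' : inR x
  · rw [if_pos h', if_pos (h.1 h')]
  · rw [if_neg h', if_neg (fun hh => h' (h.2 hh))]

lemma total_count (a b : F) (φE ω : Equiv.Perm F) (hφ : ∀ x : F, φE x = phi a b x)
    (hω : ∀ x : F, ω x = 1 + φE (φE.symm x - 1)) :
    (Finset.univ.filter fun j : F => ω j ≠ j ∧ ω (ω j) = j).card =
      ∑ w₁ : Bool, ∑ w₂ : Bool, ∑ w₃ : Bool, ∑ w₄ : Bool, nn a b w₁ w₂ w₃ w₄ := by
  set f : F → Bool × Bool × Bool × Bool := fun k =>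
    (decide (inR k), decide (inR (k - 1)), decide (inR (φE.symm (ω (φE k)))),
      decide (inR (φE.symm (ω (φE k)) - 1))) with hf
  have h1 : (Finset.univ.filter fun j : F => ω j ≠ j ∧ ω (ω j) = j).card =
      (Finset.univ.filter fun k : F => ω (φE k) ≠ φE k ∧ ω (ω (φE k)) = φE k).card := by
    rw [← Finset.card_map φE.symm.toEmbedding]
    congr 1
    ext k
    simp only [Finset.mem_map_equiv, Equiv.symm_symm, Finset.mem_filter, Finset.mem_univ, true_and]
  rw [h1, Finset.card_eq_sum_card_fiberwise (f := f) (t := univ) (fun _ _ => Finset.mem_coe.2 (Finset.mem_univ _))]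
  rw [Fintype.sum_prod_type]
  apply Finset.sum_congr rfl; intro w₁ _
  rw [Fintype.sum_prod_type]
  apply Finset.sum_congr rfl; intro w₂ _
  rw [Fintype.sum_prod_type]
  apply Finset.sum_congr rfl; intro w₃ _
  apply Finset.sum_congr rfl; intro w₄ _
  unfold nn
  congr 1
  ext k
  simp only [Finset.mem_filter, Finset.mem_univ, true_and, hf, Prod.mk.injEq]
  have dec : ∀ (p : Prop) (w : Bool), decide p = w ↔ (p ↔ w = true) := by
    intro p w; cases w <;> simp
  simp only [dec]
  have e1 : φE (φE.symm (ω (φE k))) = 1 + φE (k - 1) := by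
    rw [Equiv.apply_symm_apply, hω, Equiv.symm_apply_apply]
  have e2 : ∀ m, ω (φE m) = 1 + φE (m - 1) := by
    intro m; rw [hω, Equiv.symm_apply_apply]
  constructor
  · rintro ⟨⟨g1, g2⟩, g3, g4, g5, g6⟩
    refine ⟨φE.symm (ω (φE k)), ?_, ⟨g3, g4, g5, g6⟩, ?_, ?_⟩
    · intro h
      apply g1
      conv_rhs => rw [← h]
      rw [Equiv.apply_symm_apply]
    · rw [← phi_eq a b _ _ g3, ← phi_eq a b _ _ g6, ← hφ, ← hφ, ← e2, Equiv.apply_symm_apply, g2]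
    · rw [← phi_eq a b _ _ g5, ← phi_eq a b _ _ g4, ← hφ, ← hφ, e1]
  · rintro ⟨m, g1, ⟨g3, g4, g5, g6⟩, g7, g8⟩
    rw [← phi_eq a b _ _ g3, ← phi_eq a b _ _ g6, ← hφ, ← hφ, ← e2] at g7
    rw [← phi_eq a b _ _ g5, ← phi_eq a b _ _ g4, ← hφ, ← hφ, ← e2] at g8
    rw [← g8, Equiv.symm_apply_apply]
    refine ⟨⟨?_, ?_⟩, g3, g4, g5, g6⟩
    · intro h; exact g1 (φE.injective h)
    · exact g7.symm

lemma nn_single {a b : F} (ha : a ≠ 0) (hb : b ≠ 0) (w₁ w₂ w₃ w₄ : Bool) (hw : w₁ ≠ w₃ ∨ w₂ ≠ w₄)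
    (k m : F) (hΔ : cf a b w₁ * cf a b w₃ - cf a b w₂ * cf a b w₄ ≠ 0)
    (h1 : cf a b w₁ * k = 1 + cf a b w₄ * (m - 1)) (h2 : cf a b w₃ * m = 1 + cf a b w₂ * (k - 1)) :
    nn a b w₁ w₂ w₃ w₄ = if pat w₁ w₂ w₃ w₄ k m then 1 else 0 := by
  have uniq : ∀ k' m', TT a b w₁ w₂ w₃ w₄ k' m' → k' = k ∧ m' = m := by
    rintro k' m' ⟨_, _, g1, g2⟩
    have hk : k' = k := by
      have : (cf a b w₁ * cf a b w₃ - cf a b w₂ * cf a b w₄) * (k' - k) = 0 := by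
        linear_combination cf a b w₃ * (g1 - h1) + cf a b w₄ * (g2 - h2)
      exact sub_eq_zero.1 ((mul_eq_zero.1 this).resolve_left hΔ)
    refine ⟨hk, mul_left_cancel₀ (cf_ne ha hb w₃) ?_⟩
    rw [g2, h2, hk]
  unfold nn
  split_ifs with h
  · rw [Finset.card_eq_one]
    refine ⟨k, ?_⟩
    ext k'
    simp only [Finset.mem_filter, Finset.mem_univ, true_and, Finset.mem_singleton]
    constructor
    · rintro ⟨m', hm'⟩; exact (uniq _ _ hm').1
    · rintro rfl
      refine ⟨m, ?_, h, h1, h2⟩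
      rintro rfl
      obtain ⟨p1, p2, p3, p4⟩ := h
      rcases hw with hw | hw
      · exact hw (Bool.eq_iff_iff.2 (p1.symm.trans p3))
      · exact hw (Bool.eq_iff_iff.2 (p2.symm.trans p4))
  · rw [Finset.card_eq_zero, Finset.filter_eq_empty_iff]
    rintro k' _ ⟨m', hm'⟩
    obtain ⟨rfl, rfl⟩ := uniq _ _ hm'
    exact h hm'.2.1

lemma nn_zero {a b : F} (w₁ w₂ w₃ w₄ : Bool)
    (h : ∀ k m, m ≠ k → cf a b w₁ * k = 1 + cf a b w₄ * (m - 1) →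
      cf a b w₃ * m = 1 + cf a b w₂ * (k - 1) → False) : nn a b w₁ w₂ w₃ w₄ = 0 := by
  unfold nn
  rw [Finset.card_eq_zero, Finset.filter_eq_empty_iff]
  rintro k _ ⟨m, h1, _, h2, h3⟩
  exact h k m h1 h2 h3

lemma nn_even {a b : F} (hF : ringChar F ≠ 2) (ha1 : a ≠ 1) (hb1 : b ≠ 1) :
    nn a b true true true true = 0 ∧ nn a b false false false false = 0 ∧
    (a + b ≠ 0 → nn a b true false true false = 0 ∧ nn a b false true false true = 0) ∧
    (a + b ≠ 2 → nn a b true true false false = 0) ∧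
    (a + b ≠ 2 * a * b → nn a b true false false true = 0) := by
  have h2 : (2 : F) ≠ 0 := Ring.two_ne_zero hF
  refine ⟨?_, ?_, ?_, ?_, ?_⟩
  · apply nn_zero
    simp only [cf, if_true]
    intro k m _ e1 e2
    exact ha1 (mul_left_cancel₀ h2 (by linear_combination e1 + e2))
  · apply nn_zero
    simp only [cf, if_false, Bool.false_eq_true]
    intro k m _ e1 e2
    exact hb1 (mul_left_cancel₀ h2 (by linear_combination e1 + e2))
  · intro h
    constructor
    all_goals
      apply nn_zero
      simp only [cf, if_false, if_true, Bool.false_eq_true]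
      intro k m hne e1 e2
      have : (a + b) * (m - k) = 0 := by linear_combination e2 - e1
      exact (mul_ne_zero h (sub_ne_zero.2 hne)) this
  · intro h
    apply nn_zero
    simp only [cf, if_false, if_true, Bool.false_eq_true]
    intro k m hne e1 e2
    exact h (by linear_combination e1 + e2)
  · intro h
    apply nn_zero
    simp only [cf, if_false, if_true, Bool.false_eq_true]
    intro k m hne e1 e2
    exact h (by linear_combination -(b * e1) - a * e2)

lemma chi_div (x : F) {y : F} (hy : y ≠ 0) : χ (x / y) = χ x * χ y := by
  rw [← map_mul, ← chi_sq_mul hy (x / y)]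
  congr 1
  field_simp

lemma not_inR_zero : ¬ inR (0 : F) := fun h => h.1 rfl

end Cycles

section Final

variable {F : Type*} [Field F] [Fintype F]

local notation "χ" => quadraticChar F

/-- pattern stated through the four values -/
def pat4 (w₁ w₂ w₃ w₄ : Bool) (x y z t : F) : Prop :=
  (inR x ↔ w₁ = true) ∧ (inR y ↔ w₂ = true) ∧ (inR z ↔ w₃ = true) ∧ (inR t ↔ w₄ = true)

lemma nn_baaa {a b : F} (ha : a ≠ 0) (hb : b ≠ 0) (hab : a ≠ b) :
    nn a b false true true true = if pat4 false true true true (2 * (1 - a) / (b - a))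
      ((2 - a - b) / (b - a)) ((a + b) * (1 - a) / (a * (b - a)))
      ((a + b - 2 * a * b) / (a * (b - a))) then 1 else 0 := by
  have hd : b - a ≠ 0 := sub_ne_zero.2 hab.symm
  have e1 : 2 * (1 - a) / (b - a) - 1 = (2 - a - b) / (b - a) := by field_simp; ring
  have e2 : (a + b) * (1 - a) / (a * (b - a)) - 1 = (a + b - 2 * a * b) / (a * (b - a)) := by
    field_simp; ring
  rw [nn_single ha hb false true true true (by simp) (2 * (1 - a) / (b - a))
    ((a + b) * (1 - a) / (a * (b - a)))]
  · unfold pat pat4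
    rw [e1, e2]
  · simp only [cf, if_false, if_true, Bool.false_eq_true]
    have : b * a - a * a = a * (b - a) := by ring
    rw [this]; exact mul_ne_zero ha hd
  · rw [e2]
    simp only [cf, if_false, if_true, Bool.false_eq_true]
    field_simp
    ring
  · rw [e1]
    simp only [cf, if_false, if_true, Bool.false_eq_true]
    field_simp
    ring

lemma nn_abaa {a b : F} (ha : a ≠ 0) (hb : b ≠ 0) (hab : a ≠ b) :
    nn a b true false true true = if pat4 true false true true ((2 - a - b) / (a - b))
      (2 * (1 - a) / (a - b)) ((a + b - 2 * a * b) / (a * (a - b)))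
      ((a + b) * (1 - a) / (a * (a - b))) then 1 else 0 := by
  have hd : a - b ≠ 0 := sub_ne_zero.2 hab
  have e1 : (2 - a - b) / (a - b) - 1 = 2 * (1 - a) / (a - b) := by field_simp; ring
  have e2 : (a + b - 2 * a * b) / (a * (a - b)) - 1 = (a + b) * (1 - a) / (a * (a - b)) := by
    field_simp; ring
  rw [nn_single ha hb true false true true (by simp) ((2 - a - b) / (a - b))
    ((a + b - 2 * a * b) / (a * (a - b)))]
  · unfold pat pat4
    rw [e1, e2]
  · simp only [cf, if_false, if_true, Bool.false_eq_true]
    have : a * a - b * a = a * (a - b) := by ring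
    rw [this]; exact mul_ne_zero ha hd
  · rw [e2]
    simp only [cf, if_false, if_true, Bool.false_eq_true]
    field_simp
    ring
  · rw [e1]
    simp only [cf, if_false, if_true, Bool.false_eq_true]
    field_simp
    ring

lemma nn_abbb {a b : F} (ha : a ≠ 0) (hb : b ≠ 0) (hab : a ≠ b) :
    nn a b true false false false = if pat4 true false false false (2 * (1 - b) / (a - b))
      ((2 - a - b) / (a - b)) ((a + b) * (1 - b) / (b * (a - b)))
      ((a + b - 2 * a * b) / (b * (a - b))) then 1 else 0 := by
  have hd : a - b ≠ 0 := sub_ne_zero.2 hab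
  have e1 : 2 * (1 - b) / (a - b) - 1 = (2 - a - b) / (a - b) := by field_simp; ring
  have e2 : (a + b) * (1 - b) / (b * (a - b)) - 1 = (a + b - 2 * a * b) / (b * (a - b)) := by
    field_simp; ring
  rw [nn_single ha hb true false false false (by simp) (2 * (1 - b) / (a - b))
    ((a + b) * (1 - b) / (b * (a - b)))]
  · unfold pat pat4
    rw [e1, e2]
  · simp only [cf, if_false, if_true, Bool.false_eq_true]
    have : a * b - b * b = b * (a - b) := by ring
    rw [this]; exact mul_ne_zero hb hd
  · rw [e2]
    simp only [cf, if_false, if_true, Bool.false_eq_true]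
    field_simp
    ring
  · rw [e1]
    simp only [cf, if_false, if_true, Bool.false_eq_true]
    field_simp
    ring

lemma nn_babb {a b : F} (ha : a ≠ 0) (hb : b ≠ 0) (hab : a ≠ b) :
    nn a b false true false false = if pat4 false true false false ((2 - a - b) / (b - a))
      (2 * (1 - b) / (b - a)) ((a + b - 2 * a * b) / (b * (b - a)))
      ((a + b) * (1 - b) / (b * (b - a))) then 1 else 0 := by
  have hd : b - a ≠ 0 := sub_ne_zero.2 hab.symm
  have e1 : (2 - a - b) / (b - a) - 1 = 2 * (1 - b) / (b - a) := by field_simp; ring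
  have e2 : (a + b - 2 * a * b) / (b * (b - a)) - 1 = (a + b) * (1 - b) / (b * (b - a)) := by
    field_simp; ring
  rw [nn_single ha hb false true false false (by simp) ((2 - a - b) / (b - a))
    ((a + b - 2 * a * b) / (b * (b - a)))]
  · unfold pat pat4
    rw [e1, e2]
  · simp only [cf, if_false, if_true, Bool.false_eq_true]
    have : b * b - a * b = b * (b - a) := by ring
    rw [this]; exact mul_ne_zero hb hd
  · rw [e2]
    simp only [cf, if_false, if_true, Bool.false_eq_true]
    field_simp
    ring
  · rw [e1]
    simp only [cf, if_false, if_true, Bool.false_eq_true]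
    field_simp
    ring

/-- integers equal to `1` or `-1` -/
def pm (s : ℤ) : Prop := s = 1 ∨ s = -1

lemma pm_mul {s t : ℤ} (hs : pm s) (ht : pm t) : pm (s * t) := by
  rcases hs with rfl | rfl <;> rcases ht with rfl | rfl <;> simp [pm]

lemma int_V {D E x y z t : ℤ} (hD : pm D) (hE : pm E) (hx : pm x) (hy : pm y) (hz : pm z)
    (ht : pm t) :
    (if x * D ≠ 1 ∧ y * D = 1 ∧ z * D = 1 ∧ t * D = 1 then 1 else 0)
    + (if y * E = 1 ∧ x * E ≠ 1 ∧ t * E = 1 ∧ z * E = 1 then 1 else 0)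
    + (if x * E = 1 ∧ y * E ≠ 1 ∧ z * E ≠ 1 ∧ t * E ≠ 1 then 1 else 0)
    + (if y * D ≠ 1 ∧ x * D = 1 ∧ t * D ≠ 1 ∧ z * D ≠ 1 then 1 else 0) = 0 ∨
    (if x * D ≠ 1 ∧ y * D = 1 ∧ z * D = 1 ∧ t * D = 1 then 1 else 0)
    + (if y * E = 1 ∧ x * E ≠ 1 ∧ t * E = 1 ∧ z * E = 1 then 1 else 0)
    + (if x * E = 1 ∧ y * E ≠ 1 ∧ z * E ≠ 1 ∧ t * E ≠ 1 then 1 else 0)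
    + (if y * D ≠ 1 ∧ x * D = 1 ∧ t * D ≠ 1 ∧ z * D ≠ 1 then 1 else 0) = 2 := by
  rcases hD with rfl | rfl <;> rcases hE with rfl | rfl <;> rcases hx with rfl | rfl <;>
  rcases hy with rfl | rfl <;> rcases hz with rfl | rfl <;> rcases ht with rfl | rfl <;> decide

/-- half of the number of `k` of odd type -/
def oddN (a b : F) : ℕ := nn a b false true true true + nn a b true false true true
  + nn a b true false false false + nn a b false true false false

lemma oddN_generic {a b : F} (hF : ringChar F ≠ 2) (ha : a ≠ 0) (hb : b ≠ 0) (hab : a ≠ b)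
    (ha1 : 1 - a ≠ 0) (hb1 : 1 - b ≠ 0) (hχ : χ b = χ a) (hχ1 : χ (1 - b) = χ (1 - a))
    (h1 : a + b ≠ 0) (h2 : 2 - a - b ≠ 0) (h3 : a + b - 2 * a * b ≠ 0) :
    oddN a b = 0 ∨ oddN a b = 2 := by
  have h2F : (2 : F) ≠ 0 := Ring.two_ne_zero hF
  have hd : b - a ≠ 0 := sub_ne_zero.2 hab.symm
  have hd' : a - b ≠ 0 := sub_ne_zero.2 hab
  have dich : ∀ {x : F}, x ≠ 0 → pm (χ x) := fun h => quadraticChar_dichotomy h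
  rw [oddN, nn_baaa ha hb hab, nn_abaa ha hb hab, nn_abbb ha hb hab, nn_babb ha hb hab]
  simp only [pat4, inR_iff, Bool.false_eq_true, iff_false, iff_true, chi_div _ hd, chi_div _ hd',
    chi_div _ (mul_ne_zero ha hd), chi_div _ (mul_ne_zero ha hd'),
    chi_div _ (mul_ne_zero hb hd), chi_div _ (mul_ne_zero hb hd')]
  simp only [map_mul χ, hχ, hχ1]
  simp only [← mul_assoc]
  exact int_V (dich hd) (dich hd') (pm_mul (dich h2F) (dich ha1)) (dich h2)
    (pm_mul (pm_mul (dich h1) (dich ha1)) (dich ha)) (pm_mul (dich h3) (dich ha))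

lemma oddN_degenerate {a b : F} (ha : a ≠ 0) (hb : b ≠ 0) (hab : a ≠ b)
    (h : a + b = 0 ∨ 2 - a - b = 0 ∨ a + b - 2 * a * b = 0) : oddN a b ≤ 2 := by
  have z1 : nn a b false true true true = 0 := by
    rw [nn_baaa ha hb hab, if_neg]
    rintro ⟨_, h2, h3, h4⟩
    rcases h with h | h | h
    · rw [h, zero_mul, zero_div] at h3; exact not_inR_zero (h3.2 rfl)
    · rw [h, zero_div] at h2; exact not_inR_zero (h2.2 rfl)
    · rw [h, zero_div] at h4; exact not_inR_zero (h4.2 rfl)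
  have z2 : nn a b true false true true = 0 := by
    rw [nn_abaa ha hb hab, if_neg]
    rintro ⟨h2, _, h4, h3⟩
    rcases h with h | h | h
    · rw [h, zero_mul, zero_div] at h3; exact not_inR_zero (h3.2 rfl)
    · rw [h, zero_div] at h2; exact not_inR_zero (h2.2 rfl)
    · rw [h, zero_div] at h4; exact not_inR_zero (h4.2 rfl)
  rw [oddN, z1, z2, nn_abbb ha hb hab, nn_babb ha hb hab]
  split_ifs <;> norm_num

lemma total_formula {a b : F} (hF : ringChar F ≠ 2) (ha : a ≠ 0) (hb : b ≠ 0)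
    (ha1 : a ≠ 1) (hb1 : b ≠ 1) :
    ∑ w₁ : Bool, ∑ w₂ : Bool, ∑ w₃ : Bool, ∑ w₄ : Bool, nn a b w₁ w₂ w₃ w₄ =
      2 * oddN a b + 2 * nn a b true true false false + 2 * nn a b true false false true
      + (nn a b true false true false + nn a b false true false true) := by
  simp only [Fintype.sum_bool]
  obtain ⟨z1, z2, _⟩ := nn_even hF ha1 hb1
  rw [z1, z2, oddN, nn_swap ha hb false false true true, nn_swap ha hb false true true false,
    nn_swap ha hb true true false true, nn_swap ha hb true true true false,
    nn_swap ha hb false false true false, nn_swap ha hb false false false true]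
  ring

lemma bound_case2 {a b : F} (hF : ringChar F ≠ 2) (ha : a ≠ 0) (hb : b ≠ 0)
    (ha1 : a ≠ 1) (hb1 : b ≠ 1) (hab : a ≠ b) (h : a + b = 2) :
    |16 * (nn a b true true false false : ℝ) - Fintype.card F| ≤ 11 * √(Fintype.card F) + 22 := by
  have h2F : (2 : F) ≠ 0 := Ring.two_ne_zero hF
  have hu : a / b ≠ 0 := div_ne_zero ha hb
  have ha1' : a - 1 ≠ 0 := sub_ne_zero.2 ha1
  unfold nn
  refine count_bound hF one_ne_zero one_ne_zero hu hu (e₁ := 0) (e₂ := 1) (e₃ := (a - 1) / a)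
    (e₄ := 1 / a) zero_ne_one (div_ne_zero ha1' ha).symm (one_div_ne_zero ha).symm ?_ ?_ ?_ _ ?_
  · intro hh; field_simp at hh
    exact one_ne_zero (by linear_combination hh)
  · intro hh; field_simp at hh; exact ha1 hh
  · intro hh; field_simp at hh
    exact hb (by linear_combination h - hh)
  · intro k
    rw [Finset.mem_filter]
    simp only [Finset.mem_univ, true_and]
    have hb' : b = 2 - a := by linear_combination h
    have m1 : a / b * (k - (a - 1) / a) = (a * k - 1 + b) / b := by
      field_simp; rw [hb']; ring
    have m2 : a / b * (k - 1 / a) = (a * k - 1 + b) / b - 1 := by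
      field_simp; ring
    rw [m1, m2, one_mul, one_mul, sub_zero]
    unfold TT pat
    simp only [cf, Bool.false_eq_true, iff_false, iff_true, if_true, if_false]
    constructor
    · rintro ⟨m, _, ⟨p1, p2, p3, p4⟩, e1, e2⟩
      have : m = (a * k - 1 + b) / b := by field_simp; linear_combination -e1
      rw [← this]
      exact ⟨p1, p2, p3, p4⟩
    · rintro ⟨p1, p2, p3, p4⟩
      refine ⟨(a * k - 1 + b) / b, ?_, ⟨p1, p2, p3, p4⟩, ?_, ?_⟩
      · intro hh; rw [hh] at p3; exact p3 p1
      · field_simp; ring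
      · field_simp; linear_combination h

lemma bound_case3 {a b : F} (hF : ringChar F ≠ 2) (ha : a ≠ 0) (hb : b ≠ 0)
    (ha1 : a ≠ 1) (hb1 : b ≠ 1) (hab : a ≠ b) (h : a + b = 2 * a * b) :
    |16 * (nn a b true false false true : ℝ) - Fintype.card F| ≤ 11 * √(Fintype.card F) + 22 := by
  have ha1' : 1 - a ≠ 0 := sub_ne_zero.2 ha1.symm
  unfold nn
  refine count_bound hF one_ne_zero one_ne_zero one_ne_zero one_ne_zero (e₁ := 0) (e₂ := 1 / a)
    (e₃ := 1) (e₄ := (1 - a) / a) (one_div_ne_zero ha).symm zero_ne_one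
    (div_ne_zero ha1' ha).symm ?_ ?_ ?_ _ ?_
  · intro hh; field_simp at hh; exact ha1 hh.symm
  · intro hh; field_simp at hh
    exact ha (by linear_combination hh)
  · intro hh; field_simp at hh
    exact ha (by linear_combination h + b * hh)
  · intro k
    rw [Finset.mem_filter]
    simp only [Finset.mem_univ, true_and]
    have m1 : 1 * (k - (1 - a) / a) = k - 1 / a + 1 := by
      field_simp; ring
    have m2 : 1 * (k - 1 / a) = k - 1 / a + 1 - 1 := by ring
    rw [m1, m2, one_mul, one_mul, sub_zero]
    unfold TT pat
    simp only [cf, Bool.false_eq_true, iff_false, iff_true, if_true, if_false]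
    constructor
    · rintro ⟨m, _, ⟨p1, p2, p3, p4⟩, e1, e2⟩
      have : m = k - 1 / a + 1 := by field_simp; linear_combination -e1
      rw [← this]
      exact ⟨p1, p4, p2, p3⟩
    · rintro ⟨p1, p4, p2, p3⟩
      refine ⟨k - 1 / a + 1, ?_, ⟨p1, p2, p3, p4⟩, ?_, ?_⟩
      · intro hh; rw [hh] at p3; exact p3 p1
      · field_simp; ring
      · field_simp; linear_combination -h

lemma bound_case1 {a b : F} (hF : ringChar F ≠ 2) (ha : a ≠ 0)
    (ha1 : a ≠ 1) (hb1 : b ≠ 1) (h : a + b = 0) :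
    ((Fintype.card F : ℝ) - 11 * √(Fintype.card F) - 38 ≤ 16 * nn a b true false true false ∧
      16 * nn a b true false true false ≤ (Fintype.card F : ℝ) + 11 * √(Fintype.card F) + 22) ∧
    ((Fintype.card F : ℝ) - 11 * √(Fintype.card F) - 38 ≤ 16 * nn a b false true false true ∧
      16 * nn a b false true false true ≤ (Fintype.card F : ℝ) + 11 * √(Fintype.card F) + 22) := by
  have h2F : (2 : F) ≠ 0 := Ring.two_ne_zero hF
  have hb : b = -a := by linear_combination h
  have ham : a + 1 ≠ 0 := by
    intro hh; apply hb1; rw [hb]; linear_combination -hh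
  have ha1' : a - 1 ≠ 0 := sub_ne_zero.2 ha1
  have near : ∀ (S S' : Finset F) (c : F), (∀ k, k ∈ S' ↔ c - k ≠ k ∧ k ∈ S) →
      |16 * (S.card : ℝ) - Fintype.card F| ≤ 11 * √(Fintype.card F) + 22 →
      ((Fintype.card F : ℝ) - 11 * √(Fintype.card F) - 38 ≤ 16 * (S'.card : ℝ) ∧
      16 * (S'.card : ℝ) ≤ (Fintype.card F : ℝ) + 11 * √(Fintype.card F) + 22) := by
    intro S S' c hpp hbd
    have c1 : S'.card ≤ S.card := by
      apply Finset.card_le_card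
      intro k hk
      exact ((hpp k).1 hk).2
    have c2 : S.card ≤ S'.card + 1 := by
      have : S ⊆ insert (c / 2) S' := by
        intro k hk
        rw [Finset.mem_insert]
        by_cases hc : c - k = k
        · left; field_simp; linear_combination -hc
        · right; exact (hpp k).2 ⟨hc, hk⟩
      exact (Finset.card_le_card this).trans (Finset.card_insert_le _ _)
    have c1R : (S'.card : ℝ) ≤ S.card := by exact_mod_cast c1
    have c2R : (S.card : ℝ) ≤ S'.card + 1 := by exact_mod_cast c2
    rw [abs_le] at hbd
    constructor <;> linarith [hbd.1, hbd.2]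
  unfold nn
  constructor
  · refine near (univ.filter fun k => inR k ∧ inR ((1 + a) / a - k) ∧ ¬ inR (k - 1) ∧
      ¬ inR ((1 + a) / a - k - 1)) _ ((1 + a) / a) ?_ ?_
    · intro k
      rw [Finset.mem_filter, Finset.mem_filter]
      simp only [Finset.mem_univ, true_and]
      unfold TT pat
      simp only [cf, Bool.false_eq_true, iff_false, iff_true, if_true, if_false]
      constructor
      · rintro ⟨m, p0, ⟨p1, p2, p3, p4⟩, e1, e2⟩
        have : m = (1 + a) / a - k := by
          rw [hb] at e1
          field_simp; linear_combination e1
        rw [← this]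
        exact ⟨p0, p1, p3, p2, p4⟩
      · rintro ⟨p0, p1, p3, p2, p4⟩
        refine ⟨(1 + a) / a - k, p0, ⟨p1, p2, p3, p4⟩, ?_, ?_⟩
        · rw [hb]; field_simp; ring
        · rw [hb]; field_simp; ring
    · refine count_bound hF (u₁ := 1) (u₂ := -1) (u₃ := 1) (u₄ := -1) one_ne_zero
        (neg_ne_zero.2 one_ne_zero) one_ne_zero (neg_ne_zero.2 one_ne_zero) (e₁ := 0)
        (e₂ := (1 + a) / a) (e₃ := 1) (e₄ := 1 / a) ?_ zero_ne_one (one_div_ne_zero ha).symm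
        ?_ ?_ ?_ _ ?_
      · intro hh; field_simp at hh; exact ham (by linear_combination -hh)
      · intro hh; field_simp at hh; exact one_ne_zero (by linear_combination hh)
      · intro hh; field_simp at hh; exact ha (by linear_combination hh)
      · intro hh; field_simp at hh; exact ha1 hh
      · intro k
        rw [Finset.mem_filter]
        simp only [Finset.mem_univ, true_and]
        have m1 : -1 * (k - (1 + a) / a) = (1 + a) / a - k := by ring
        have m2 : -1 * (k - 1 / a) = (1 + a) / a - k - 1 := by field_simp; ring
        rw [m1, m2, one_mul, one_mul, sub_zero]
  · refine near (univ.filter fun k => inR (k - 1) ∧ inR ((a - 1) / a - k - 1) ∧ ¬ inR k ∧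
      ¬ inR ((a - 1) / a - k)) _ ((a - 1) / a) ?_ ?_
    · intro k
      rw [Finset.mem_filter, Finset.mem_filter]
      simp only [Finset.mem_univ, true_and]
      unfold TT pat
      simp only [cf, Bool.false_eq_true, iff_false, iff_true, if_true, if_false]
      constructor
      · rintro ⟨m, p0, ⟨p1, p2, p3, p4⟩, e1, e2⟩
        have : m = (a - 1) / a - k := by
          rw [hb] at e1
          field_simp; linear_combination -e1
        rw [← this]
        exact ⟨p0, p2, p4, p1, p3⟩
      · rintro ⟨p0, p2, p4, p1, p3⟩
        refine ⟨(a - 1) / a - k, p0, ⟨p1, p2, p3, p4⟩, ?_, ?_⟩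
        · rw [hb]; field_simp; ring
        · rw [hb]; field_simp; ring
    · refine count_bound hF (u₁ := 1) (u₂ := -1) (u₃ := 1) (u₄ := -1) one_ne_zero
        (neg_ne_zero.2 one_ne_zero) one_ne_zero (neg_ne_zero.2 one_ne_zero) (e₁ := 1)
        (e₂ := -1 / a) (e₃ := 0) (e₄ := (a - 1) / a) ?_ one_ne_zero ?_
        ?_ ?_ (div_ne_zero ha1' ha).symm _ ?_
      · intro hh; field_simp at hh; exact ham (by linear_combination hh)
      · intro hh; field_simp at hh; exact one_ne_zero (by linear_combination hh)
      · exact div_ne_zero (neg_ne_zero.2 one_ne_zero) ha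
      · intro hh; field_simp at hh; exact ha (by linear_combination -hh)
      · intro k
        rw [Finset.mem_filter]
        simp only [Finset.mem_univ, true_and]
        have m1 : -1 * (k - (a - 1) / a) = (a - 1) / a - k := by ring
        have m2 : -1 * (k - -1 / a) = (a - 1) / a - k - 1 := by field_simp; ring
        rw [m1, m2, one_mul, one_mul, sub_zero]

end Final

/-- Lemma 2.12: the number `M` of transpositions (2-cycles) of `ω = ω[a,b]`, i.e. half the
cardinality of `{j : ω(j) ≠ j ∧ ω(ω(j)) = j}`, satisfies: `M ∈ {0, 2}` if
`b ∉ {-a, 2-a, a/(2a-1)}`, and `(q - 11√q - 38)/16 ≤ M ≤ (q + 11√q + 70)/16` otherwise. -/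
theorem transposition_count
    (hodd : Odd (Fintype.card F)) (a b : F) (hv : ValidPair a b) (hab : a ≠ b)
    (φE ω : Equiv.Perm F)
    (hφ : ∀ x : F, φE x = phi a b x)
    (hω : ∀ x : F, ω x = 1 + φE (φE.symm x - 1))
    (M : ℕ)
    (hM : 2 * M = (Finset.univ.filter fun j : F => ω j ≠ j ∧ ω (ω j) = j).card) :
    ((b ≠ -a ∧ b ≠ 2 - a ∧ b ≠ a / (2 * a - 1)) → (M = 0 ∨ M = 2)) ∧
    ((b = -a ∨ b = 2 - a ∨ b = a / (2 * a - 1)) →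
      (((Fintype.card F : ℝ) - 11 * Real.sqrt (Fintype.card F) - 38) / 16 ≤ (M : ℝ) ∧
        (M : ℝ) ≤ ((Fintype.card F : ℝ) + 11 * Real.sqrt (Fintype.card F) + 70) / 16)) := by
  have hF : ringChar F ≠ 2 := by
    intro h
    have := FiniteField.even_card_of_char_two h
    rw [Nat.odd_iff] at hodd
    omega
  have h2F : (2 : F) ≠ 0 := Ring.two_ne_zero hF
  obtain ⟨hv1, hv2⟩ := hv
  have ha : a ≠ 0 := left_ne_zero_of_mul hv1.1
  have hb : b ≠ 0 := right_ne_zero_of_mul hv1.1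
  have ha1' : a - 1 ≠ 0 := left_ne_zero_of_mul hv2.1
  have hb1' : b - 1 ≠ 0 := right_ne_zero_of_mul hv2.1
  have ha1 : a ≠ 1 := sub_ne_zero.1 ha1'
  have hb1 : b ≠ 1 := sub_ne_zero.1 hb1'
  have same : ∀ {x y : F}, x ≠ 0 → y ≠ 0 → inR (x * y) →
      quadraticChar F y = quadraticChar F x := by
    intro x y hx hy h
    rw [inR_iff, map_mul] at h
    rcases quadraticChar_dichotomy hx with h1 | h1 <;>
      rcases quadraticChar_dichotomy hy with h2 | h2 <;> rw [h1, h2] at h ⊢ <;> norm_num at h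
  have hχ := same ha hb hv1
  have hχ1 : quadraticChar F (1 - b) = quadraticChar F (1 - a) := by
    apply same (sub_ne_zero.2 ha1.symm) (sub_ne_zero.2 hb1.symm)
    have : (1 - a) * (1 - b) = (a - 1) * (b - 1) := by ring
    rw [this]; exact hv2
  rw [total_count a b φE ω hφ hω, total_formula hF ha hb ha1 hb1] at hM
  obtain ⟨_, _, z1, z2, z3⟩ := nn_even (a := a) (b := b) hF ha1 hb1
  have i3 : b = a / (2 * a - 1) ↔ a + b = 2 * a * b := by
    by_cases h : 2 * a - 1 = 0
    · rw [h, div_zero]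
      constructor
      · intro hh; exact absurd hh hb
      · intro hh; exact absurd (by linear_combination hh + b * h : a = 0) ha
    · rw [eq_div_iff h]
      constructor <;> intro hh
      · linear_combination -hh
      · linear_combination -hh
  constructor
  · rintro ⟨n1, n2, n3⟩
    have m1 : a + b ≠ 0 := fun h => n1 (by linear_combination h)
    have m2 : a + b ≠ 2 := fun h => n2 (by linear_combination h)
    have m3 : a + b ≠ 2 * a * b := fun h => n3 (i3.2 h)
    have := oddN_generic hF ha hb hab (sub_ne_zero.2 ha1.symm) (sub_ne_zero.2 hb1.symm) hχ hχ1
      m1 (fun h => m2 (by linear_combination -h)) (sub_ne_zero.2 m3)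
    have y1 := z1 m1
    have y2 := z2 m2
    have y3 := z3 m3
    omega
  · intro h
    have hsq := Real.sqrt_nonneg (Fintype.card F : ℝ)
    have hMR : (2 : ℝ) * M = 2 * oddN a b + 2 * nn a b true true false false
        + 2 * nn a b true false false true
        + (nn a b true false true false + nn a b false true false true) := by exact_mod_cast hM
    have hodd0 : (0 : ℝ) ≤ oddN a b := Nat.cast_nonneg _
    have hdeg : a + b = 0 ∨ 2 - a - b = 0 ∨ a + b - 2 * a * b = 0 := by
      rcases h with h | h | h
      · left; rw [h]; ring
      · right; left; rw [h]; ring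
      · right; right; exact sub_eq_zero.2 (i3.1 h)
    have hodd2 : (oddN a b : ℝ) ≤ 2 := by exact_mod_cast oddN_degenerate ha hb hab hdeg
    have x12 : a + b = 0 → a + b = 2 → False := fun h1 h2 => h2F (by rw [← h2, h1])
    have x13 : a + b = 0 → a + b = 2 * a * b → False := fun h1 h2 =>
      mul_ne_zero (mul_ne_zero h2F ha) hb (by rw [← h2, h1])
    have x23 : a + b = 2 → a + b = 2 * a * b → False := by
      intro h1 h2
      have e : a * b = 1 := mul_left_cancel₀ h2F (by linear_combination h1 - h2)
      have : (a - 1) * (a - 1) = 0 := by linear_combination a * h1 - e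
      exact mul_ne_zero ha1' ha1' this
    rcases hdeg with h | h | h
    · have y2 := z2 (x12 h)
      have y3 := z3 (x13 h)
      obtain ⟨b1, b2⟩ := bound_case1 hF ha ha1 hb1 h
      rw [y2, y3] at hMR
      push_cast at hMR
      constructor <;> linarith [b1.1, b1.2, b2.1, b2.2]
    · have h' : a + b = 2 := by linear_combination -h
      obtain ⟨y1, y1'⟩ := z1 (fun hh => x12 hh h')
      have y3 := z3 (x23 h')
      have bd := bound_case2 hF ha hb ha1 hb1 hab h'
      rw [abs_le] at bd
      rw [y1, y1', y3] at hMR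
      push_cast at hMR
      constructor <;> linarith [bd.1, bd.2]
    · have h' : a + b = 2 * a * b := sub_eq_zero.1 h
      obtain ⟨y1, y1'⟩ := z1 (fun hh => x13 hh h')
      have y2 := z2 (fun hh => x23 hh h')
      have bd := bound_case3 hF ha hb ha1 hb1 hab h'
      rw [abs_le] at bd
      rw [y1, y1', y2] at hMR
      push_cast at hMR
      constructor <;> linarith [bd.1, bd.2]
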